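/- arXiv:2301.03762 — 2 statements merged into one kernel-verified Lean document; each statement's English description precedes it below -/
import Mathlib

section
/- Let n ≥ 2 and let h be a Hessenberg function on [n] with h(j) ≥ j+1 for all j ∈ [n−1]. Then the ℚ-algebra R(h) is generated by the images of the degree-2 elements of H(h) ⊗ ℚ if and only if h is of lollipop form. -/
open MvPolynomial

/-- The GKM condition over `ℚ`: `f` belongs to the GKM ring `H(h) ⊗ ℚ` of the Hessenberg
function `h` (0-based indexing: position `j : Fin n` corresponds to `j+1 ∈ [n]`). -/
def InGKMQ {n : ℕ} (h : Fin n → Fin n)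
    (f : Equiv.Perm (Fin n) → MvPolynomial (Fin n) ℚ) : Prop :=
  ∀ (w : Equiv.Perm (Fin n)) (i j : Fin n), j < i → i ≤ h j →
    f w - f (w * Equiv.swap i j) ∈ Ideal.span {X (w i) - X (w j)}

/-- An element of the GKM ring has (cohomological) degree 2 when all of its values are
homogeneous polynomials of degree 1 (including the zero polynomial). -/
def DegTwoQ {n : ℕ} (f : Equiv.Perm (Fin n) → MvPolynomial (Fin n) ℚ) : Prop :=
  ∀ w, (f w).IsHomogeneous 1

/-- `R(h) = (H(h) ⊗ ℚ) / (t_1, …, t_n)` is generated by the images of the degree-2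
elements:  every `f ∈ H(h) ⊗ ℚ` is, modulo the ideal of `H(h) ⊗ ℚ` generated by the
constant functions `t_1, …, t_n`, a polynomial in degree-2 elements of `H(h) ⊗ ℚ`. -/
def GenInDegTwoQ {n : ℕ} (h : Fin n → Fin n) : Prop :=
  ∀ f : Equiv.Perm (Fin n) → MvPolynomial (Fin n) ℚ, InGKMQ h f →
    ∃ g ∈ Algebra.adjoin ℚ
        {f' : Equiv.Perm (Fin n) → MvPolynomial (Fin n) ℚ | InGKMQ h f' ∧ DegTwoQ f'},
      ∃ a : Fin n → Equiv.Perm (Fin n) → MvPolynomial (Fin n) ℚ,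
        (∀ i, InGKMQ h (a i)) ∧ f = g + ∑ i, a i * (fun _ => X i)

/-- `h` is of lollipop form: there are `1 ≤ a < b ≤ n` (1-based) with `h(j) = a+1` for
`1 ≤ j ≤ a`, `h(j) = j+1` for `a < j < b`, and `h(j) = n` for `b ≤ j ≤ n`.
Below `a b : ℕ` are the 0-based versions (`a = a₁ - 1`, `b = b₁ - 1`). -/
def Lollipop {n : ℕ} (h : Fin n → Fin n) : Prop :=
  ∃ a b : ℕ, a < b ∧ b ≤ n - 1 ∧
    (∀ j : Fin n, (j : ℕ) ≤ a → (h j : ℕ) = a + 1) ∧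
    (∀ j : Fin n, a < (j : ℕ) → (j : ℕ) < b → (h j : ℕ) = (j : ℕ) + 1) ∧
    (∀ j : Fin n, b ≤ (j : ℕ) → (h j : ℕ) = n - 1)

namespace Lolli

variable {n : ℕ}

abbrev Fun (n : ℕ) := Equiv.Perm (Fin n) → MvPolynomial (Fin n) ℚ

/-- The subalgebra generated by the degree-two classes. -/
noncomputable abbrev Gen2 (h : Fin n → Fin n) : Subalgebra ℚ (Fun n) :=
  Algebra.adjoin ℚ {f' : Fun n | InGKMQ h f' ∧ DegTwoQ f'}

lemma const_X_mem (h : Fin n → Fin n) (i : Fin n) : (fun _ => X i : Fun n) ∈ Gen2 h := by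
  apply Algebra.subset_adjoin
  refine ⟨fun w i j _ _ => by simp, fun w => isHomogeneous_X _ _⟩

lemma const_mem (h : Fin n → Fin n) (p : MvPolynomial (Fin n) ℚ) :
    (fun _ => p : Fun n) ∈ Gen2 h := by
  induction p using MvPolynomial.induction_on with
  | C a => exact (Gen2 h).algebraMap_mem a
  | add p q hp hq => exact (Gen2 h).add_mem hp hq
  | mul_X p i hp => exact (Gen2 h).mul_mem hp (const_X_mem h i)

lemma gen_approx {R : Type*} [CommRing R] (θ : MvPolynomial (Fin n) ℚ →+* R) (z : R)
    (hθ : ∀ i, z ∣ θ (X i)) {h : Fin n → Fin n} (H : GenInDegTwoQ h) (k : ℕ) :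
    ∀ f, InGKMQ h f → ∃ g ∈ Gen2 h, ∀ w, z ^ k ∣ θ (f w) - θ (g w) := by
  induction k with
  | zero => intro f _; exact ⟨0, Subalgebra.zero_mem _, by simp⟩
  | succ k ih =>
    intro f hf
    obtain ⟨g, hg, a, ha, rfl⟩ := H f hf
    choose b hb hb' using fun i => ih (a i) (ha i)
    refine ⟨g + ∑ i, b i * (fun _ => X i), ?_, ?_⟩
    · exact (Gen2 h).add_mem hg ((Gen2 h).sum_mem fun i _ => (Gen2 h).mul_mem (hb i) (const_X_mem h i))
    · intro w
      have : θ ((g + ∑ i, a i * (fun _ => X i) : Fun n) w) - θ ((g + ∑ i, b i * (fun _ => X i) : Fun n) w)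
        = ∑ i, (θ (a i w) - θ (b i w)) * θ (X i) := by
        simp [sub_mul, Finset.sum_sub_distrib]
      rw [this]
      refine Finset.dvd_sum fun i _ => ?_
      rw [pow_succ]
      exact mul_dvd_mul (hb' i w) (hθ i)

/-- moving along an edge -/
lemma X_swap_mem (u : Equiv.Perm (Fin n)) (i j y : Fin n) :
    (X (u y) - X ((u * Equiv.swap i j) y) : MvPolynomial (Fin n) ℚ) ∈
      Ideal.span {(X (u i) - X (u j) : MvPolynomial (Fin n) ℚ)} := by
  rw [Ideal.mem_span_singleton]
  by_cases h1 : y = i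
  · subst h1; simp
  by_cases h2 : y = j
  · subst h2; simp only [Equiv.Perm.mul_apply, Equiv.swap_apply_right]
    exact ⟨-1, by ring⟩
  · simp [Equiv.swap_apply_of_ne_of_ne h1 h2]

lemma gkm_ite {R : Type*} [CommRing R] (I : Ideal R) (P P' : Prop) [Decidable P] [Decidable P']
    (g g' : R) (hg : g - g' ∈ I) (hP : ¬ (P ↔ P') → g ∈ I) :
    (if P then g else 0) - (if P' then g' else 0) ∈ I := by
  by_cases h1 : P <;> by_cases h2 : P'
  · simpa [h1, h2] using hg
  · simpa [h1, h2] using hP (by tauto)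
  · have := I.sub_mem (hP (by tauto)) hg
    simp only [h1, h2, if_true, if_false]
    simpa using this
  · simp [h1, h2]

lemma deg_one_edge {p : MvPolynomial (Fin n) ℚ} (hp : p.IsHomogeneous 1) {a b : Fin n} (hab : a ≠ b)
    (hm : p ∈ Ideal.span {(X a - X b : MvPolynomial (Fin n) ℚ)}) : ∃ c : ℚ, p = C c * (X a - X b) := by
  obtain ⟨q, rfl⟩ := Ideal.mem_span_singleton.1 hm
  by_cases hq : q = 0
  · exact ⟨0, by simp [hq]⟩
  have hne : (X a - X b : MvPolynomial (Fin n) ℚ) ≠ 0 := by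
    intro h0; exact hab (X_injective (sub_eq_zero.1 h0))
  have h1 := hp.totalDegree (mul_ne_zero hne hq)
  have h2 : (X a - X b : MvPolynomial (Fin n) ℚ).totalDegree = 1 :=
    ((isHomogeneous_X ℚ a).sub (isHomogeneous_X ℚ b)).totalDegree hne
  rw [totalDegree_mul_of_isDomain hne hq, h2] at h1
  have h3 : q.totalDegree = 0 := by omega
  rw [totalDegree_eq_zero_iff_eq_C] at h3
  exact ⟨coeff 0 q, by rw [h3]; simp [mul_comm]⟩

lemma edge_coeff {h : Fin n → Fin n} {f : Fun n} (hf : InGKMQ h f) (hd : DegTwoQ f)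
    {i j : Fin n} (hij : i < j) (hj : j ≤ h i) (w : Equiv.Perm (Fin n)) :
    ∃ c : ℚ, f w - f (w * Equiv.swap i j) = C c * (X (w i) - X (w j)) := by
  have := hf w j i hij hj
  rw [Equiv.swap_comm] at this
  obtain ⟨c, hc⟩ := deg_one_edge ((hd w).sub (hd _)) (fun e => hij.ne' (w.injective e)) this
  exact ⟨-c, by rw [hc]; simp; ring⟩

/-- Thom class of a face. -/
noncomputable def thom (h : Fin n → Fin n) (c : Fin n → ℕ) (w0 : Equiv.Perm (Fin n)) : Fun n := fun w =>
  if ∀ i, c (w0.symm (w i)) = c i then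
    ∏ e ∈ Finset.univ.filter (fun e : Fin n × Fin n => e.1 < e.2 ∧ e.2 ≤ h e.1 ∧ c e.1 ≠ c e.2),
      (X (w e.1) - X (w e.2))
  else 0

lemma thom_gkm (h : Fin n → Fin n) (c : Fin n → ℕ) (w0 : Equiv.Perm (Fin n)) :
    InGKMQ h (thom h c w0) := by
  intro w i j hji hi
  unfold thom
  apply gkm_ite
  · rw [← Ideal.Quotient.eq, map_prod, map_prod]
    refine Finset.prod_congr rfl fun e _ => ?_
    rw [map_sub, map_sub, Ideal.Quotient.eq.2 (X_swap_mem w i j e.1),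
      Ideal.Quotient.eq.2 (X_swap_mem w i j e.2)]
  · intro hP
    have hc : c j ≠ c i := by
      intro hc
      apply hP
      have key : ∀ v : Equiv.Perm (Fin n), (∀ k, c (w0.symm (v k)) = c k) →
          ∀ k, c (w0.symm ((v * Equiv.swap i j) k)) = c k := by
        intro v hv k
        rw [Equiv.Perm.mul_apply, hv]
        by_cases h1 : k = i
        · subst h1; simp [hc]
        by_cases h2 : k = j
        · subst h2; simp [hc]
        · rw [Equiv.swap_apply_of_ne_of_ne h1 h2]
      refine ⟨key w, fun h' => ?_⟩
      simpa [mul_assoc] using key _ h'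
    rw [Ideal.mem_span_singleton]
    have : (X (w j) - X (w i) : MvPolynomial (Fin n) ℚ) ∣ ∏ e ∈ Finset.univ.filter
      (fun e : Fin n × Fin n => e.1 < e.2 ∧ e.2 ≤ h e.1 ∧ c e.1 ≠ c e.2), (X (w e.1) - X (w e.2)) :=
      Finset.dvd_prod_of_mem (fun e : Fin n × Fin n => (X (w e.1) - X (w e.2) : MvPolynomial (Fin n) ℚ))
        (a := (j, i)) (by simp [hji, hi, hc])
    rw [← neg_sub]
    exact (neg_dvd).2 this

end Lolli

namespace Lolli

variable {n : ℕ}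

lemma diamond_deg {h : Fin n → Fin n} {f : Fun n} (hf : InGKMQ h f) (hd : DegTwoQ f)
    {i j k l : Fin n} (hij : i < j) (hjk : j < k) (hkl : k < l) (e1 : j ≤ h i) (e2 : k ≤ h i)
    (e3 : l ≤ h j) (e4 : l ≤ h k) :
    ∃ c : ℚ, f 1 - f (Equiv.swap i l) = C c * (X i - X l) := by
  have path : ∀ m : Fin n, i < m → m < l → m ≤ h i → l ≤ h m →
      ∃ a b c : ℚ, f 1 - f (Equiv.swap i l) = C a * (X i - X m) + C b * (X i - X l) + C c * (X m - X l) := by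
    intro m h1 h2 h3 h4
    obtain ⟨a, ha⟩ := edge_coeff hf hd h1 h3 1
    obtain ⟨b, hb⟩ := edge_coeff hf hd h2 h4 (Equiv.swap i m)
    obtain ⟨c, hc⟩ := edge_coeff hf hd h1 h3 (Equiv.swap i m * Equiv.swap m l)
    have hs : Equiv.swap i m * Equiv.swap m l * Equiv.swap i m = Equiv.swap i l := by
      have := Equiv.swap_mul_swap_mul_swap (x := l) (y := m) (z := i) h2.ne' (h1.trans h2).ne'
      rw [Equiv.swap_comm l m, Equiv.swap_comm m i] at this
      exact this
    rw [hs] at hc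
    have n1 : i ≠ l := (h1.trans h2).ne
    have n2 : l ≠ i := n1.symm
    have n3 : l ≠ m := h2.ne'
    simp only [Equiv.Perm.mul_apply, Equiv.Perm.one_apply, one_mul, Equiv.swap_apply_right,
      Equiv.swap_apply_left, Equiv.swap_apply_of_ne_of_ne n2 n3,
      Equiv.swap_apply_of_ne_of_ne h1.ne n1] at ha hb hc
    exact ⟨a, b, c, by linear_combination ha + hb + hc⟩
  obtain ⟨a, b, c, h1⟩ := path j hij (hjk.trans hkl) e1 e3
  obtain ⟨a', b', c', h2⟩ := path k (hij.trans hjk) hkl e2 e4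
  have h3 := congrArg (MvPolynomial.eval (Pi.single j (1 : ℚ))) (h1.symm.trans h2)
  have m1 : i ≠ j := hij.ne
  have m2 : l ≠ j := (hjk.trans hkl).ne'
  have m3 : k ≠ j := hjk.ne'
  simp [m1, m2, m3] at h3
  have h4 : a = c := by linarith
  exact ⟨a + b, by rw [h1, h4]; simp; ring⟩

lemma X_pow_dvd_all {p : Polynomial ℚ} (hp : ∀ k, Polynomial.X ^ k ∣ p) : p = 0 := by
  by_contra h0
  have := Polynomial.natDegree_le_of_dvd (hp (p.natDegree + 1)) h0
  simp at this

lemma not_gen_diamond {h : Fin n → Fin n}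
    {i j k l : Fin n} (hij : i < j) (hjk : j < k) (hkl : k < l) (e1 : j ≤ h i) (e2 : k ≤ h i)
    (e3 : l ≤ h j) (e4 : l ≤ h k) (ne : h i < l) : ¬ GenInDegTwoQ h := by
  intro H
  have hil : i < l := hij.trans (hjk.trans hkl)
  let c : Fin n → ℚ := fun v => if v = l then (i : ℕ) else (v : ℕ)
  let θ : MvPolynomial (Fin n) ℚ →+* Polynomial ℚ :=
    (MvPolynomial.aeval (fun v => Polynomial.C (c v) * Polynomial.X)).toRingHom
  have hθ : ∀ v, θ (X v) = Polynomial.C (c v) * Polynomial.X := fun v => by simp [θ]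
  have hg : ∀ g ∈ Gen2 h, θ (g 1) = θ (g (Equiv.swap i l)) := by
    intro g hg
    induction hg using Algebra.adjoin_induction with
    | mem x hx =>
      obtain ⟨a, ha⟩ := diamond_deg hx.1 hx.2 hij hjk hkl e1 e2 e3 e4
      have := congrArg θ ha
      rw [map_sub, map_mul, map_sub, hθ, hθ] at this
      have hc : c i = c l := by simp [c]
      rw [hc, sub_self, mul_zero] at this
      exact sub_eq_zero.1 this
    | algebraMap r => simp
    | add x y _ _ hx hy => simp [hx, hy]
    | mul x y _ _ hx hy => simp [hx, hy]
  let F := thom h (fun v => (v : ℕ)) 1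
  have hF0 : F (Equiv.swap i l) = 0 := by
    simp only [F, thom]
    rw [if_neg]
    intro hh
    have := hh i
    simp at this
    exact hil.ne' (Fin.ext this)
  have hF1 : F 1 = ∏ e ∈ Finset.univ.filter (fun e : Fin n × Fin n => e.1 < e.2 ∧ e.2 ≤ h e.1 ∧
      (e.1 : ℕ) ≠ e.2), (X e.1 - X e.2) := by
    simp [F, thom]
    intro x hx
    exact absurd rfl hx
  have hz : θ (F 1) = 0 := by
    apply X_pow_dvd_all
    intro k
    obtain ⟨g, hgm, hdv⟩ := gen_approx θ Polynomial.X (fun i => by rw [hθ]; exact dvd_mul_left _ _)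
      H k F (thom_gkm _ _ _)
    have := dvd_sub (hdv 1) (hdv (Equiv.swap i l))
    rw [hg g hgm, hF0] at this
    simpa using this
  rw [hF1, map_prod, Finset.prod_eq_zero_iff] at hz
  obtain ⟨⟨a, b⟩, he, hz⟩ := hz
  simp only [Finset.mem_filter, Finset.mem_univ, true_and] at he
  rw [map_sub, hθ, hθ, ← sub_mul, ← Polynomial.C_sub] at hz
  have hc : c a - c b = 0 := by
    rcases mul_eq_zero.1 hz with h1 | h1
    · exact Polynomial.C_eq_zero.1 h1
    · exact absurd h1 Polynomial.X_ne_zero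
  simp only [c] at hc
  obtain ⟨h1, h2, h3⟩ := he
  split_ifs at hc with q1 q2 q2
  · exact h3 (by rw [q1, q2])
  · have : (i : ℕ) = b := by exact_mod_cast sub_eq_zero.1 hc
    subst q1; omega
  · have : (a : ℕ) = i := by exact_mod_cast sub_eq_zero.1 hc
    have : a = i := Fin.ext this
    subst q2; subst this; omega
  · exact h3 (by exact_mod_cast sub_eq_zero.1 hc)

end Lolli

namespace Lolli

variable {n : ℕ}

/-- `f` satisfies the degree-one GKM condition along the transposition of `i` and `j`. -/
def EdgeC (f : Fun n) (i j : Fin n) : Prop :=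
  ∀ w : Equiv.Perm (Fin n), ∃ c : ℚ, f w - f (w * Equiv.swap i j) = C c * (X (w i) - X (w j))

lemma EdgeC.symm {f : Fun n} {i j : Fin n} (H : EdgeC f i j) : EdgeC f j i := by
  intro w
  obtain ⟨c, hc⟩ := H w
  rw [Equiv.swap_comm]
  exact ⟨-c, by rw [hc]; simp; ring⟩

lemma square {f : Fun n} {i j k l : Fin n} (H : EdgeC f k l) (hij : i ≠ j)
    (hik : i ≠ k) (hil : i ≠ l) (hjk : j ≠ k) (hjl : j ≠ l) (w : Equiv.Perm (Fin n)) (c c' : ℚ)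
    (hc : f w - f (w * Equiv.swap i j) = C c * (X (w i) - X (w j)))
    (hc' : f (w * Equiv.swap k l) - f (w * Equiv.swap k l * Equiv.swap i j)
      = C c' * (X ((w * Equiv.swap k l) i) - X ((w * Equiv.swap k l) j))) : c' = c := by
  obtain ⟨d, hd⟩ := H w
  obtain ⟨d', hd'⟩ := H (w * Equiv.swap i j)
  have hcomm : w * Equiv.swap k l * Equiv.swap i j = w * Equiv.swap i j * Equiv.swap k l := by
    rw [mul_assoc, mul_assoc]
    congr 1
    ext x
    simp only [Equiv.Perm.mul_apply, Equiv.swap_apply_def]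
    split_ifs <;> simp_all
  rw [hcomm] at hc'
  simp only [Equiv.Perm.mul_apply, Equiv.swap_apply_of_ne_of_ne hik hil,
    Equiv.swap_apply_of_ne_of_ne hjk hjl, Equiv.swap_apply_of_ne_of_ne hik.symm hjk.symm,
    Equiv.swap_apply_of_ne_of_ne hil.symm hjl.symm] at hc' hd'
  have key : C c * (X (w i) - X (w j)) + C d' * (X (w k) - X (w l))
    = C d * (X (w k) - X (w l)) + C c' * (X (w i) - X (w j)) := by
    linear_combination hd + hc' - hc - hd'
  have h3 := congrArg (MvPolynomial.eval (Pi.single (w i) (1 : ℚ))) key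
  have m1 : w j ≠ w i := fun e => hij (w.injective e).symm
  have m2 : w k ≠ w i := fun e => hik (w.injective e).symm
  have m3 : w l ≠ w i := fun e => hil (w.injective e).symm
  simp [m1, m2, m3] at h3
  exact h3.symm

lemma triangle {f : Fun n} {i j k : Fin n} (H1 : EdgeC f i j) (H2 : EdgeC f i k) (hij : i ≠ j)
    (hik : i ≠ k) (hjk : j ≠ k) (w : Equiv.Perm (Fin n)) (c c' : ℚ)
    (hc : f w - f (w * Equiv.swap j k) = C c * (X (w j) - X (w k)))
    (hc' : f (w * Equiv.swap i j) - f (w * Equiv.swap i j * Equiv.swap j k)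
      = C c' * (X ((w * Equiv.swap i j) j) - X ((w * Equiv.swap i j) k))) : c' = c := by
  obtain ⟨a, ha⟩ := H1 w
  obtain ⟨e, he⟩ := H2 (w * Equiv.swap i j * Equiv.swap j k)
  have hcomm : w * Equiv.swap i j * Equiv.swap j k * Equiv.swap i k = w * Equiv.swap j k := by
    rw [mul_assoc, mul_assoc]
    congr 1
    ext x
    simp only [Equiv.Perm.mul_apply, Equiv.swap_apply_def]
    split_ifs <;> simp_all
  rw [hcomm] at he
  simp only [Equiv.Perm.mul_apply, Equiv.swap_apply_of_ne_of_ne hij hik, Equiv.swap_apply_left,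
    Equiv.swap_apply_right, Equiv.swap_apply_of_ne_of_ne hik.symm hjk.symm] at hc' he
  have key : C a * (X (w i) - X (w j)) + C c' * (X (w i) - X (w k)) + C e * (X (w j) - X (w i))
    = C c * (X (w j) - X (w k)) := by
    linear_combination hc - ha - hc' - he
  have h3 := congrArg (MvPolynomial.eval (Pi.single (w k) (1 : ℚ))) key
  have m2 : w j ≠ w k := fun e => hjk (w.injective e)
  have m3 : w i ≠ w k := fun e => hik (w.injective e)
  simp [m2, m3] at h3
  exact h3

section hex

lemma coeff_mul_two {K : Type*} [CommRing K] (p q : Polynomial K) :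
    (p * q).coeff 2 = p.coeff 0 * q.coeff 2 + p.coeff 1 * q.coeff 1 + p.coeff 2 * q.coeff 0 := by
  rw [Polynomial.coeff_mul, show (Finset.HasAntidiagonal.antidiagonal 2 : Finset (ℕ × ℕ)) = {(0, 2), (1, 1), (2, 0)} from rfl]
  simp [add_assoc]

variable {K : Type*} [CommRing K]

/-- First order behaviour on (four of the six vertices of) a hexagon. -/
structure Hex (r1 r2 r3 r4 : Polynomial K) (b d s α γ κ : K) : Prop where
  z1 : r1.coeff 0 = s
  z2 : r2.coeff 0 = s
  z3 : r3.coeff 0 = s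
  z4 : r4.coeff 0 = s
  o1 : r1.coeff 1 = κ - α * b
  o2 : r2.coeff 1 = κ + γ * d
  o3 : r3.coeff 1 = κ - α * b - γ * (b - d)
  o4 : r4.coeff 1 = κ + γ * d - α * (b - d)

/-- Second order functional on a hexagon. -/
def hexN (r1 r2 r3 r4 : Polynomial K) (b d : K) : K :=
  - b * r1.coeff 2 - d * r2.coeff 2 + d * r3.coeff 2 + b * r4.coeff 2

lemma Hex.add {r1 r2 r3 r4 q1 q2 q3 q4 : Polynomial K} {b d s α γ κ s' α' γ' κ' : K}
    (H : Hex r1 r2 r3 r4 b d s α γ κ) (H' : Hex q1 q2 q3 q4 b d s' α' γ' κ') :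
    Hex (r1 + q1) (r2 + q2) (r3 + q3) (r4 + q4) b d (s + s') (α + α') (γ + γ') (κ + κ') := by
  obtain ⟨a1, a2, a3, a4, a5, a6, a7, a8⟩ := H
  obtain ⟨b1, b2, b3, b4, b5, b6, b7, b8⟩ := H'
  constructor <;> simp only [Polynomial.coeff_add, *] <;> ring

lemma Hex.mul {r1 r2 r3 r4 q1 q2 q3 q4 : Polynomial K} {b d s α γ κ s' α' γ' κ' : K}
    (H : Hex r1 r2 r3 r4 b d s α γ κ) (H' : Hex q1 q2 q3 q4 b d s' α' γ' κ') :
    Hex (r1 * q1) (r2 * q2) (r3 * q3) (r4 * q4) b d (s * s') (s * α' + s' * α) (s * γ' + s' * γ)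
      (s * κ' + s' * κ) := by
  obtain ⟨a1, a2, a3, a4, a5, a6, a7, a8⟩ := H
  obtain ⟨b1, b2, b3, b4, b5, b6, b7, b8⟩ := H'
  constructor <;> simp only [Polynomial.mul_coeff_zero, Polynomial.mul_coeff_one, *] <;> ring

lemma hexN_add (r1 r2 r3 r4 q1 q2 q3 q4 : Polynomial K) (b d : K) :
    hexN (r1 + q1) (r2 + q2) (r3 + q3) (r4 + q4) b d = hexN r1 r2 r3 r4 b d + hexN q1 q2 q3 q4 b d := by
  simp only [hexN, Polynomial.coeff_add]; ring

lemma hexN_mul {r1 r2 r3 r4 q1 q2 q3 q4 : Polynomial K} {b d s α γ κ s' α' γ' κ' : K}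
    (H : Hex r1 r2 r3 r4 b d s α γ κ) (H' : Hex q1 q2 q3 q4 b d s' α' γ' κ') :
    hexN (r1 * q1) (r2 * q2) (r3 * q3) (r4 * q4) b d =
      s * hexN q1 q2 q3 q4 b d + s' * hexN r1 r2 r3 r4 b d
        - b * d * (b - d) * (α * α' - γ * γ') := by
  obtain ⟨a1, a2, a3, a4, a5, a6, a7, a8⟩ := H
  obtain ⟨b1, b2, b3, b4, b5, b6, b7, b8⟩ := H'
  simp only [hexN, coeff_mul_two, *]; ring

end hex
end Lolli

namespace Lolli

variable {n : ℕ}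

lemma hex_deg {f : Fun n} {p m q : Fin n} (H1 : EdgeC f p m) (H2 : EdgeC f m q) (H3 : EdgeC f p q)
    (hpm : p ≠ m) (hpq : p ≠ q) (hmq : m ≠ q) (w : Equiv.Perm (Fin n)) (α γ : ℚ)
    (hα : f w - f (w * Equiv.swap p m) = C α * (X (w p) - X (w m)))
    (hγ : f w - f (w * Equiv.swap m q) = C γ * (X (w m) - X (w q))) :
    f (w * Equiv.swap p m) = f w - C α * (X (w p) - X (w m)) ∧
    f (w * Equiv.swap m q) = f w - C γ * (X (w m) - X (w q)) ∧
    f (w * Equiv.swap p m * Equiv.swap m q) =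
      f w - C α * (X (w p) - X (w m)) - C γ * (X (w p) - X (w q)) ∧
    f (w * Equiv.swap m q * Equiv.swap p m) =
      f w - C γ * (X (w m) - X (w q)) - C α * (X (w p) - X (w q)) := by
  refine ⟨by linear_combination -hα, by linear_combination -hγ, ?_, ?_⟩
  · obtain ⟨c', hc'⟩ := H2 (w * Equiv.swap p m)
    have := triangle H1 H3 hpm hpq hmq w γ c' hγ hc'
    subst this
    simp only [Equiv.Perm.mul_apply, Equiv.swap_apply_right,
      Equiv.swap_apply_of_ne_of_ne hpq.symm hmq.symm] at hc'
    linear_combination -hα - hc'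
  · obtain ⟨c', hc'⟩ := H1.symm (w * Equiv.swap m q)
    rw [Equiv.swap_comm m q] at hc'
    have := triangle H2.symm H3.symm hmq.symm hpq.symm hpm.symm w (-α) c'
      (by rw [Equiv.swap_comm, hα]; simp; ring) hc'
    subst this
    simp only [Equiv.Perm.mul_apply, Equiv.swap_apply_right,
      Equiv.swap_apply_of_ne_of_ne hpq hpm] at hc'
    rw [Equiv.swap_comm m p, Equiv.swap_comm q m] at hc'
    simp only [C_neg] at hc'
    linear_combination -hγ - hc'

noncomputable section

abbrev K := Polynomial ℚ
abbrev RR := Polynomial K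

def Z : K := Polynomial.X

/-- The substitution `t_v ↦ Z (c_v + τ_v ε)`. -/
def theta (c τ : Fin n → ℚ) : MvPolynomial (Fin n) ℚ →+* RR :=
  (MvPolynomial.aeval (fun v => (Polynomial.C (Z * Polynomial.C (c v)) +
    Polynomial.C (Z * Polynomial.C (τ v)) * Polynomial.X : RR))).toRingHom

lemma theta_X (c τ : Fin n → ℚ) (v : Fin n) : theta c τ (X v) =
    Polynomial.C (Z * Polynomial.C (c v)) +
    Polynomial.C (Z * Polynomial.C (τ v)) * Polynomial.X := by simp [theta]

lemma theta_C (c τ : Fin n → ℚ) (a : ℚ) : theta c τ (C a) = Polynomial.C (Polynomial.C a) := by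
  have : (C a : MvPolynomial (Fin n) ℚ) = algebraMap ℚ _ a := rfl
  rw [this]
  simp only [theta]
  exact (MvPolynomial.aeval (fun v => (Polynomial.C (Z * Polynomial.C (c v)) +
    Polynomial.C (Z * Polynomial.C (τ v)) * Polynomial.X : RR))).commutes a

lemma hex_of {f : Fun n} {p m q : Fin n} (H1 : EdgeC f p m) (H2 : EdgeC f m q) (H3 : EdgeC f p q)
    (hpm : p ≠ m) (hpq : p ≠ q) (hmq : m ≠ q) (w : Equiv.Perm (Fin n)) (α γ : ℚ)
    (hα : f w - f (w * Equiv.swap p m) = C α * (X (w p) - X (w m)))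
    (hγ : f w - f (w * Equiv.swap m q) = C γ * (X (w m) - X (w q)))
    (c τ : Fin n → ℚ) (b d : K)
    (hb : theta c τ (X (w p)) = Polynomial.C (Z * b) * Polynomial.X)
    (hc : theta c τ (X (w m)) = 0)
    (hd : theta c τ (X (w q)) = Polynomial.C (Z * d) * Polynomial.X) :
    Hex (theta c τ (f (w * Equiv.swap p m))) (theta c τ (f (w * Equiv.swap m q)))
      (theta c τ (f (w * Equiv.swap p m * Equiv.swap m q)))
      (theta c τ (f (w * Equiv.swap m q * Equiv.swap p m))) b d
      ((theta c τ (f w)).coeff 0) (Z * Polynomial.C α) (Z * Polynomial.C γ)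
      ((theta c τ (f w)).coeff 1) ∧
    hexN (theta c τ (f (w * Equiv.swap p m))) (theta c τ (f (w * Equiv.swap m q)))
      (theta c τ (f (w * Equiv.swap p m * Equiv.swap m q)))
      (theta c τ (f (w * Equiv.swap m q * Equiv.swap p m))) b d = 0 := by
  obtain ⟨h1, h2, h3, h4⟩ := hex_deg H1 H2 H3 hpm hpq hmq w α γ hα hγ
  have e1 : theta c τ (f (w * Equiv.swap p m)) = theta c τ (f w) -
      Polynomial.C (Z * Polynomial.C α * b) * Polynomial.X := by
    rw [h1]; simp only [map_sub, map_mul, hb, hc, theta_C]; ring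
  have e2 : theta c τ (f (w * Equiv.swap m q)) = theta c τ (f w) +
      Polynomial.C (Z * Polynomial.C γ * d) * Polynomial.X := by
    rw [h2]; simp only [map_sub, map_mul, hd, hc, theta_C]; ring
  have e3 : theta c τ (f (w * Equiv.swap p m * Equiv.swap m q)) = theta c τ (f w) -
      Polynomial.C (Z * Polynomial.C α * b + Z * Polynomial.C γ * (b - d)) * Polynomial.X := by
    rw [h3]; simp only [map_sub, map_mul, map_add, hb, hc, hd, theta_C]; ring
  have e4 : theta c τ (f (w * Equiv.swap m q * Equiv.swap p m)) = theta c τ (f w) +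
      Polynomial.C (Z * Polynomial.C γ * d - Z * Polynomial.C α * (b - d)) * Polynomial.X := by
    rw [h4]; simp only [map_sub, map_mul, hb, hc, hd, theta_C]; ring
  rw [e1, e2, e3, e4]
  constructor
  · constructor <;> simp only [Polynomial.coeff_add, Polynomial.coeff_sub, Polynomial.coeff_C_mul,
      Polynomial.coeff_X_zero, Polynomial.coeff_X_one] <;> ring
  · simp only [hexN, Polynomial.coeff_add, Polynomial.coeff_sub, Polynomial.coeff_C_mul,
      Polynomial.coeff_X]
    norm_num

/-- The hidden second-order condition for bull graphs. -/
def Hidden (o p m q r : Fin n) (G : Equiv.Perm (Fin n) → RR) : Prop :=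
  let S := Equiv.swap p m
  let T := Equiv.swap m q
  let B2 := Equiv.swap o p
  let B3 := Equiv.swap q r
  let B4 := Equiv.swap o p * Equiv.swap q r
  (∃ s α1 α2 γ1 γ2 k1 k2 k3 k4 : K,
    Hex (G (1 * S)) (G (1 * T)) (G (1 * S * T)) (G (1 * T * S)) (-1) 2 s α1 γ1 k1 ∧
    Hex (G (B2 * S)) (G (B2 * T)) (G (B2 * S * T)) (G (B2 * T * S)) 1 2 s α2 γ1 k2 ∧
    Hex (G (B3 * S)) (G (B3 * T)) (G (B3 * S * T)) (G (B3 * T * S)) (-1) 3 s α1 γ2 k3 ∧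
    Hex (G (B4 * S)) (G (B4 * T)) (G (B4 * S * T)) (G (B4 * T * S)) 1 3 s α2 γ2 k4) ∧
  -2 * hexN (G (1 * S)) (G (1 * T)) (G (1 * S * T)) (G (1 * T * S)) (-1) 2
  - 6 * hexN (G (B2 * S)) (G (B2 * T)) (G (B2 * S * T)) (G (B2 * T * S)) 1 2
  + hexN (G (B3 * S)) (G (B3 * T)) (G (B3 * S * T)) (G (B3 * T * S)) (-1) 3
  + 2 * hexN (G (B4 * S)) (G (B4 * T)) (G (B4 * S * T)) (G (B4 * T * S)) 1 3 = 0

lemma Hidden.add {o p m q r : Fin n} {G G' : Equiv.Perm (Fin n) → RR}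
    (H : Hidden o p m q r G) (H' : Hidden o p m q r G') : Hidden o p m q r (G + G') := by
  obtain ⟨⟨s, α1, α2, γ1, γ2, k1, k2, k3, k4, h1, h2, h3, h4⟩, h5⟩ := H
  obtain ⟨⟨s', α1', α2', γ1', γ2', k1', k2', k3', k4', h1', h2', h3', h4'⟩, h5'⟩ := H'
  refine ⟨⟨_, _, _, _, _, _, _, _, _, h1.add h1', h2.add h2', h3.add h3', h4.add h4'⟩, ?_⟩
  simp only [Pi.add_apply, hexN_add]
  linear_combination h5 + h5'

lemma Hidden.mul {o p m q r : Fin n} {G G' : Equiv.Perm (Fin n) → RR}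
    (H : Hidden o p m q r G) (H' : Hidden o p m q r G') : Hidden o p m q r (G * G') := by
  obtain ⟨⟨s, α1, α2, γ1, γ2, k1, k2, k3, k4, h1, h2, h3, h4⟩, h5⟩ := H
  obtain ⟨⟨s', α1', α2', γ1', γ2', k1', k2', k3', k4', h1', h2', h3', h4'⟩, h5'⟩ := H'
  refine ⟨⟨_, _, _, _, _, _, _, _, _, h1.mul h1', h2.mul h2', h3.mul h3', h4.mul h4'⟩, ?_⟩
  simp only [Pi.mul_apply, hexN_mul h1 h1', hexN_mul h2 h2', hexN_mul h3 h3', hexN_mul h4 h4']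
  linear_combination s' * h5 + s * h5'

lemma Hidden.const {o p m q r : Fin n} (a : K) :
    Hidden o p m q r (fun _ => Polynomial.C a) := by
  have H : ∀ b d : K, Hex (Polynomial.C a) (Polynomial.C a) (Polynomial.C a) (Polynomial.C a) b d a 0 0 0 := by
    intro b d
    constructor <;> simp [Polynomial.coeff_C]
  refine ⟨⟨_, _, _, _, _, _, _, _, _, H _ _, H _ _, H _ _, H _ _⟩, ?_⟩
  simp [hexN]

end

end Lolli

namespace Lolli

variable {n : ℕ}

noncomputable section

/-- base point: zero on the five positions, distinct and nonzero elsewhere -/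
def cc (o p m q r : Fin n) (v : Fin n) : ℚ :=
  if v = o ∨ v = p ∨ v = m ∨ v = q ∨ v = r then 0 else (v : ℕ) + 1

def tt (o p m q r : Fin n) (v : Fin n) : ℚ :=
  if v = o then 1 else if v = p then -1 else if v = m then 0 else if v = q then 2
    else if v = r then 3 else 0

lemma hidden_deg {f : Fun n} {o p m q r : Fin n} (Hop : EdgeC f o p) (H1 : EdgeC f p m)
    (H2 : EdgeC f m q) (H3 : EdgeC f p q) (Hqr : EdgeC f q r)
    (op : o < p) (pm : p < m) (mq : m < q) (qr : q < r) :
    Hidden o p m q r (fun w => theta (cc o p m q r) (tt o p m q r) (f w)) := by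
  set c := cc o p m q r with hcdef
  set τ := tt o p m q r with htdef
  have om := op.trans pm
  have oq := om.trans mq
  have or := oq.trans qr
  have pq := pm.trans mq
  have pr := pq.trans qr
  have mr := mq.trans qr
  have To : theta c τ (X o) = Polynomial.C (Z * 1) * Polynomial.X := by
    rw [theta_X]; simp [hcdef, htdef, cc, tt]
  have Tp : theta c τ (X p) = Polynomial.C (Z * (-1)) * Polynomial.X := by
    rw [theta_X]; simp [hcdef, htdef, cc, tt, op.ne']
  have Tm : theta c τ (X m) = 0 := by
    rw [theta_X]; simp [hcdef, htdef, cc, tt, om.ne', pm.ne']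
  have Tq : theta c τ (X q) = Polynomial.C (Z * 2) * Polynomial.X := by
    rw [theta_X]; simp [hcdef, htdef, cc, tt, oq.ne', pq.ne', mq.ne']; exact Or.inl rfl
  have Tr : theta c τ (X r) = Polynomial.C (Z * 3) * Polynomial.X := by
    rw [theta_X]; simp [hcdef, htdef, cc, tt, or.ne', pr.ne', mr.ne', qr.ne']; exact Or.inl rfl
  -- edge coefficients at the four bases
  obtain ⟨a1, ha1⟩ := H1 1
  obtain ⟨g1, hg1⟩ := H2 1
  obtain ⟨a2, ha2⟩ := H1 (Equiv.swap o p)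
  obtain ⟨g1', hg1'⟩ := H2 (Equiv.swap o p)
  obtain ⟨a1', ha1'⟩ := H1 (Equiv.swap q r)
  obtain ⟨g2, hg2⟩ := H2 (Equiv.swap q r)
  obtain ⟨a2', ha2'⟩ := H1 (Equiv.swap o p * Equiv.swap q r)
  obtain ⟨g2', hg2'⟩ := H2 (Equiv.swap o p * Equiv.swap q r)
  have hcomm : Equiv.swap o p * Equiv.swap q r = Equiv.swap q r * Equiv.swap o p := by
    ext x
    simp only [Equiv.Perm.mul_apply, Equiv.swap_apply_def]
    have := op.ne; have := oq.ne; have := or.ne; have := pq.ne; have := pr.ne; have := qr.ne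
    split_ifs <;> simp_all
  have q1 : g1' = g1 := square Hop mq.ne om.ne' pm.ne' oq.ne' pq.ne' 1 g1 g1' hg1
    (by simpa only [one_mul] using hg1')
  have q2 : a1' = a1 := square Hqr pm.ne pq.ne pr.ne mq.ne mr.ne 1 a1 a1' ha1
    (by simpa only [one_mul] using ha1')
  have q3 : a2' = a2 := square Hqr pm.ne pq.ne pr.ne mq.ne mr.ne _ a2 a2' ha2 ha2'
  have q4 : g2' = g2 := square Hop mq.ne om.ne' pm.ne' oq.ne' pq.ne' _ g2 g2' hg2
    (by rw [← hcomm]; exact hg2')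
  subst q1 q2 q3 q4
  -- constant terms
  obtain ⟨u1, hu1⟩ := Hop 1
  obtain ⟨u2, hu2⟩ := Hqr 1
  obtain ⟨u3, hu3⟩ := Hqr (Equiv.swap o p)
  have z1 : (theta c τ (f (Equiv.swap o p))).coeff 0 = (theta c τ (f 1)).coeff 0 := by
    have := congrArg (fun x => (theta c τ x).coeff 0) hu1
    simp [To, Tp] at this
    exact (sub_eq_zero.1 this).symm
  have z2 : (theta c τ (f (Equiv.swap q r))).coeff 0 = (theta c τ (f 1)).coeff 0 := by
    have := congrArg (fun x => (theta c τ x).coeff 0) hu2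
    simp [Tq, Tr] at this
    exact (sub_eq_zero.1 this).symm
  have z3 : (theta c τ (f (Equiv.swap o p * Equiv.swap q r))).coeff 0 = (theta c τ (f 1)).coeff 0 := by
    have := congrArg (fun x => (theta c τ x).coeff 0) hu3
    simp [Equiv.swap_apply_of_ne_of_ne oq.ne' pq.ne', Equiv.swap_apply_of_ne_of_ne or.ne' pr.ne',
      Tq, Tr] at this
    rw [← sub_eq_zero.1 this, z1]
  have X1 := hex_of H1 H2 H3 pm.ne pq.ne mq.ne 1 _ _ ha1 hg1 c τ (-1) 2 (by simpa using Tp)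
    (by simpa using Tm) (by simpa using Tq)
  have X2 := hex_of H1 H2 H3 pm.ne pq.ne mq.ne (Equiv.swap o p) _ _ ha2 hg1' c τ 1 2
    (by simpa using To)
    (by rw [Equiv.swap_apply_of_ne_of_ne om.ne' pm.ne']; exact Tm)
    (by rw [Equiv.swap_apply_of_ne_of_ne oq.ne' pq.ne']; exact Tq)
  have X3 := hex_of H1 H2 H3 pm.ne pq.ne mq.ne (Equiv.swap q r) _ _ ha1' hg2 c τ (-1) 3
    (by rw [Equiv.swap_apply_of_ne_of_ne pq.ne pr.ne]; exact Tp)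
    (by rw [Equiv.swap_apply_of_ne_of_ne mq.ne mr.ne]; exact Tm)
    (by simpa using Tr)
  have X4 := hex_of H1 H2 H3 pm.ne pq.ne mq.ne (Equiv.swap o p * Equiv.swap q r) _ _ ha2' hg2' c τ 1 3
    (by rw [Equiv.Perm.mul_apply, Equiv.swap_apply_of_ne_of_ne pq.ne pr.ne]; simpa using To)
    (by rw [Equiv.Perm.mul_apply, Equiv.swap_apply_of_ne_of_ne mq.ne mr.ne,
          Equiv.swap_apply_of_ne_of_ne om.ne' pm.ne']; exact Tm)
    (by rw [Equiv.Perm.mul_apply, Equiv.swap_apply_left,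
          Equiv.swap_apply_of_ne_of_ne or.ne' pr.ne']; exact Tr)
  rw [z1] at X2
  rw [z2] at X3
  rw [z3] at X4
  refine ⟨⟨_, _, _, _, _, _, _, _, _, X1.1, X2.1, X3.1, X4.1⟩, ?_⟩
  simp only [X1.2, X2.2, X3.2, X4.2]
  ring

lemma hidden_gen {h : Fin n → Fin n} {o p m q r : Fin n}
    (op : o < p) (pm : p < m) (mq : m < q) (qr : q < r)
    (e1 : p ≤ h o) (e2 : m ≤ h p) (e3 : q ≤ h p) (e4 : q ≤ h m) (e5 : r ≤ h q)
    (g : Fun n) (hg : g ∈ Gen2 h) :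
    Hidden o p m q r (fun w => theta (cc o p m q r) (tt o p m q r) (g w)) := by
  induction hg using Algebra.adjoin_induction with
  | mem x hx =>
    exact hidden_deg (edge_coeff hx.1 hx.2 op e1) (edge_coeff hx.1 hx.2 pm e2)
      (edge_coeff hx.1 hx.2 mq e4) (edge_coeff hx.1 hx.2 (pm.trans mq) e3)
      (edge_coeff hx.1 hx.2 qr e5) op pm mq qr
  | algebraMap a =>
    have : (fun w => theta (cc o p m q r) (tt o p m q r) ((algebraMap ℚ (Fun n)) a w)) =
        fun _ => Polynomial.C (Polynomial.C a) := by
      funext w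
      exact theta_C _ _ a
    rw [this]
    exact Hidden.const _
  | add x y _ _ hx hy =>
    have := hx.add hy
    convert this using 1
    funext w; simp
  | mul x y _ _ hx hy =>
    have := hx.mul hy
    convert this using 1
    funext w; simp

end
end Lolli

namespace Lolli

variable {n : ℕ}

noncomputable section

def lam (o p m q r : Fin n) (G : Equiv.Perm (Fin n) → RR) : K :=
  -2 * hexN (G (1 * Equiv.swap p m)) (G (1 * Equiv.swap m q))
    (G (1 * Equiv.swap p m * Equiv.swap m q)) (G (1 * Equiv.swap m q * Equiv.swap p m)) (-1) 2
  - 6 * hexN (G (Equiv.swap o p * Equiv.swap p m)) (G (Equiv.swap o p * Equiv.swap m q))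
    (G (Equiv.swap o p * Equiv.swap p m * Equiv.swap m q))
    (G (Equiv.swap o p * Equiv.swap m q * Equiv.swap p m)) 1 2
  + hexN (G (Equiv.swap q r * Equiv.swap p m)) (G (Equiv.swap q r * Equiv.swap m q))
    (G (Equiv.swap q r * Equiv.swap p m * Equiv.swap m q))
    (G (Equiv.swap q r * Equiv.swap m q * Equiv.swap p m)) (-1) 3
  + 2 * hexN (G (Equiv.swap o p * Equiv.swap q r * Equiv.swap p m))
    (G (Equiv.swap o p * Equiv.swap q r * Equiv.swap m q))
    (G (Equiv.swap o p * Equiv.swap q r * Equiv.swap p m * Equiv.swap m q))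
    (G (Equiv.swap o p * Equiv.swap q r * Equiv.swap m q * Equiv.swap p m)) 1 3

lemma hexN_dvd (z : K) (r1 r2 r3 r4 s1 s2 s3 s4 : RR) (b d : K)
    (h1 : Polynomial.C z ∣ r1 - s1) (h2 : Polynomial.C z ∣ r2 - s2)
    (h3 : Polynomial.C z ∣ r3 - s3) (h4 : Polynomial.C z ∣ r4 - s4) :
    z ∣ hexN r1 r2 r3 r4 b d - hexN s1 s2 s3 s4 b d := by
  rw [Polynomial.C_dvd_iff_dvd_coeff] at h1 h2 h3 h4
  obtain ⟨a1, k1⟩ := h1 2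
  obtain ⟨a2, k2⟩ := h2 2
  obtain ⟨a3, k3⟩ := h3 2
  obtain ⟨a4, k4⟩ := h4 2
  rw [Polynomial.coeff_sub] at k1 k2 k3 k4
  refine ⟨-b * a1 - d * a2 + d * a3 + b * a4, ?_⟩
  simp only [hexN]
  linear_combination -b * k1 - d * k2 + d * k3 + b * k4

lemma lam_dvd (z : K) (o p m q r : Fin n) (G G' : Equiv.Perm (Fin n) → RR)
    (hG : ∀ w, Polynomial.C z ∣ G w - G' w) : z ∣ lam o p m q r G - lam o p m q r G' := by
  unfold lam
  generalize hA1 : hexN (G (1 * Equiv.swap p m)) (G (1 * Equiv.swap m q))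
    (G (1 * Equiv.swap p m * Equiv.swap m q)) (G (1 * Equiv.swap m q * Equiv.swap p m)) (-1) 2 = A1
  generalize hB1 : hexN (G' (1 * Equiv.swap p m)) (G' (1 * Equiv.swap m q))
    (G' (1 * Equiv.swap p m * Equiv.swap m q)) (G' (1 * Equiv.swap m q * Equiv.swap p m)) (-1) 2 = B1
  have E1 : z ∣ A1 - B1 := by
    rw [← hA1, ← hB1]; exact hexN_dvd _ _ _ _ _ _ _ _ _ _ _ (hG _) (hG _) (hG _) (hG _)
  obtain ⟨x1, E1⟩ := E1
  obtain ⟨x2, E2⟩ := hexN_dvd z _ _ _ _ _ _ _ _ 1 2 (hG (Equiv.swap o p * Equiv.swap p m))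
    (hG (Equiv.swap o p * Equiv.swap m q))
    (hG (Equiv.swap o p * Equiv.swap p m * Equiv.swap m q))
    (hG (Equiv.swap o p * Equiv.swap m q * Equiv.swap p m))
  obtain ⟨x3, E3⟩ := hexN_dvd z _ _ _ _ _ _ _ _ (-1) 3 (hG (Equiv.swap q r * Equiv.swap p m))
    (hG (Equiv.swap q r * Equiv.swap m q))
    (hG (Equiv.swap q r * Equiv.swap p m * Equiv.swap m q))
    (hG (Equiv.swap q r * Equiv.swap m q * Equiv.swap p m))
  obtain ⟨x4, E4⟩ := hexN_dvd z _ _ _ _ _ _ _ _ 1 3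
    (hG (Equiv.swap o p * Equiv.swap q r * Equiv.swap p m))
    (hG (Equiv.swap o p * Equiv.swap q r * Equiv.swap m q))
    (hG (Equiv.swap o p * Equiv.swap q r * Equiv.swap p m * Equiv.swap m q))
    (hG (Equiv.swap o p * Equiv.swap q r * Equiv.swap m q * Equiv.swap p m))
  refine ⟨-2 * x1 - 6 * x2 + x3 + 2 * x4, ?_⟩
  linear_combination -2 * E1 - 6 * E2 + E3 + 2 * E4

/-- the colouring -/
def col (o p m q r : Fin n) (v : Fin n) : ℕ :=
  if v = o ∨ v = p then n else if v = m ∨ v = q ∨ v = r then n + 1 else v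

lemma thom_zero {h : Fin n → Fin n} {c : Fin n → ℕ} {w0 w : Equiv.Perm (Fin n)} (i : Fin n)
    (hi : c (w0.symm (w i)) ≠ c i) : thom h c w0 w = 0 := by
  unfold thom
  rw [if_neg]
  exact fun H => hi (H i)

lemma not_gen_bull {h : Fin n → Fin n} (hmono : Monotone h) {o p m q r : Fin n}
    (op : o < p) (pm : p < m) (mq : m < q) (qr : q < r)
    (e1 : p ≤ h o) (n1 : h o < m) (e3 : q ≤ h p) (n2 : h p < r) (e5 : r ≤ h q) :
    ¬ GenInDegTwoQ h := by
  intro H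
  have om := op.trans pm
  have oq := om.trans mq
  have or := oq.trans qr
  have pq := pm.trans mq
  have pr := pq.trans qr
  have mr := mq.trans qr
  set F := thom h (col o p m q r) (Equiv.swap p q) with hF
  set θ := theta (cc o p m q r) (tt o p m q r) with hθ
  have hz : ∀ i, (Polynomial.C Z : RR) ∣ θ (X i) := by
    intro i
    rw [hθ, theta_X]
    exact ⟨Polynomial.C (Polynomial.C (cc o p m q r i)) +
      Polynomial.C (Polynomial.C (tt o p m q r i)) * Polynomial.X, by
        simp only [map_mul]; ring⟩
  have L0 : lam o p m q r (fun w => θ (F w)) = 0 := by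
    apply X_pow_dvd_all
    intro k
    obtain ⟨g, hg, hk⟩ := gen_approx θ (Polynomial.C Z) hz H k F (thom_gkm _ _ _)
    have h0 : lam o p m q r (fun w => θ (g w)) = 0 :=
      (hidden_gen op pm mq qr e1 (mq.le.trans e3) e3 (e3.trans (hmono pm.le)) e5 g hg).2
    have := lam_dvd (Z ^ k) o p m q r (fun w => θ (F w)) (fun w => θ (g w))
      (fun w => by rw [map_pow]; exact hk w)
    rwa [h0, sub_zero] at this
  have co : col o p m q r o = n := by simp [col]
  have cp : col o p m q r p = n := by simp [col]
  have cm : col o p m q r m = n + 1 := by simp [col, om.ne', pm.ne']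
  have cq : col o p m q r q = n + 1 := by simp [col, oq.ne', pq.ne']
  have cr : col o p m q r r = n + 1 := by simp [col, or.ne', pr.ne']
  have zo : ∀ w : Equiv.Perm (Fin n), w o = p → F w = 0 := by
    intro w hw; apply thom_zero o; rw [hw]; simp [co, cq]
  have zr : ∀ w : Equiv.Perm (Fin n), w r = q → F w = 0 := by
    intro w hw; apply thom_zero r; rw [hw]; simp [cr, cp]
  have zp1 : ∀ w : Equiv.Perm (Fin n), w p = m → F w = 0 := by
    intro w hw; apply thom_zero p; rw [hw]
    simp [Equiv.swap_apply_of_ne_of_ne pm.ne' mq.ne, cm, cp]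
  have zp2 : ∀ w : Equiv.Perm (Fin n), w p = p → F w = 0 := by
    intro w hw; apply thom_zero p; rw [hw]; simp [cp, cq]
  have sw : ∀ {a b x : Fin n}, x ≠ a → x ≠ b → Equiv.swap a b x = x :=
    fun h1 h2 => Equiv.swap_apply_of_ne_of_ne h1 h2
  set ws : Equiv.Perm (Fin n) := 1 * Equiv.swap m q * Equiv.swap p m with hws
  have wp : ws p = q := by simp [hws]
  have wm : ws m = p := by simp [hws, sw pm.ne pq.ne]
  have wq : ws q = m := by simp [hws, sw pq.ne' mq.ne']
  have wo : ∀ x, x ≠ p → x ≠ m → x ≠ q → ws x = x := by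
    intro x h1 h2 h3; simp [hws, sw h1 h2, sw h2 h3]
  have L1 : lam o p m q r (fun w => θ (F w)) = 2 * (θ (F ws)).coeff 2 := by
    have a1 : F (1 * Equiv.swap p m) = 0 := zp1 _ (by simp)
    have a2 : F (1 * Equiv.swap m q) = 0 := zp2 _ (by simp [sw pm.ne pq.ne])
    have a3 : F (1 * Equiv.swap p m * Equiv.swap m q) = 0 := zp1 _ (by simp [sw pm.ne pq.ne])
    have b1 : F (Equiv.swap o p * Equiv.swap p m) = 0 := zo _ (by simp [sw op.ne om.ne])
    have b2 : F (Equiv.swap o p * Equiv.swap m q) = 0 := zo _ (by simp [sw om.ne oq.ne])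
    have b3 : F (Equiv.swap o p * Equiv.swap p m * Equiv.swap m q) = 0 :=
      zo _ (by simp [sw om.ne oq.ne, sw op.ne om.ne])
    have b4 : F (Equiv.swap o p * Equiv.swap m q * Equiv.swap p m) = 0 :=
      zo _ (by simp [sw om.ne oq.ne, sw op.ne om.ne])
    have c1 : F (Equiv.swap q r * Equiv.swap p m) = 0 := zr _ (by simp [sw pr.ne' mr.ne'])
    have c2 : F (Equiv.swap q r * Equiv.swap m q) = 0 := zr _ (by simp [sw mr.ne' qr.ne'])
    have c3 : F (Equiv.swap q r * Equiv.swap p m * Equiv.swap m q) = 0 :=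
      zr _ (by simp [sw pr.ne' mr.ne', sw mr.ne' qr.ne'])
    have c4 : F (Equiv.swap q r * Equiv.swap m q * Equiv.swap p m) = 0 :=
      zr _ (by simp [sw pr.ne' mr.ne', sw mr.ne' qr.ne'])
    have d1 : F (Equiv.swap o p * Equiv.swap q r * Equiv.swap p m) = 0 :=
      zo _ (by simp [sw op.ne om.ne, sw oq.ne or.ne])
    have d2 : F (Equiv.swap o p * Equiv.swap q r * Equiv.swap m q) = 0 :=
      zo _ (by simp [sw om.ne oq.ne, sw oq.ne or.ne])
    have d3 : F (Equiv.swap o p * Equiv.swap q r * Equiv.swap p m * Equiv.swap m q) = 0 :=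
      zo _ (by simp [sw om.ne oq.ne, sw op.ne om.ne, sw oq.ne or.ne])
    have d4 : F (Equiv.swap o p * Equiv.swap q r * Equiv.swap m q * Equiv.swap p m) = 0 :=
      zo _ (by simp [sw om.ne oq.ne, sw op.ne om.ne, sw oq.ne or.ne])
    simp only [lam, a1, a2, a3, b1, b2, b3, b4, c1, c2, c3, c4, d1, d2, d3, d4, hexN, map_zero,
      Polynomial.coeff_zero]
    ring
  have hP : ∀ i, col o p m q r ((Equiv.swap p q).symm (ws i)) = col o p m q r i := by
    intro i
    by_cases h1 : i = p
    · subst h1; simp [wp]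
    by_cases h2 : i = m
    · subst h2; simp [wm, cq, cm]
    by_cases h3 : i = q
    · subst h3; simp [wq, sw pm.ne' mq.ne, cq, cm]
    · simp [wo i h1 h2 h3, sw h1 h3]
  have hFw : F ws = ∏ e ∈ Finset.univ.filter (fun e : Fin n × Fin n => e.1 < e.2 ∧ e.2 ≤ h e.1 ∧
      col o p m q r e.1 ≠ col o p m q r e.2), (X (ws e.1) - X (ws e.2)) := by
    rw [hF]; unfold thom; rw [if_pos hP]
  have m1 : (p, m) ∈ Finset.univ.filter (fun e : Fin n × Fin n => e.1 < e.2 ∧ e.2 ≤ h e.1 ∧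
      col o p m q r e.1 ≠ col o p m q r e.2) := by
    simp [pm, cp, cm, mq.le.trans e3]
  have m2 : (p, q) ∈ (Finset.univ.filter (fun e : Fin n × Fin n => e.1 < e.2 ∧ e.2 ≤ h e.1 ∧
      col o p m q r e.1 ≠ col o p m q r e.2)).erase (p, m) := by
    simp [pq, cp, cq, e3, mq.ne']
  rw [← Finset.mul_prod_erase _ _ m1, ← Finset.mul_prod_erase _ _ m2] at hFw
  set P := ∏ e ∈ ((Finset.univ.filter (fun e : Fin n × Fin n => e.1 < e.2 ∧ e.2 ≤ h e.1 ∧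
      col o p m q r e.1 ≠ col o p m q r e.2)).erase (p, m)).erase (p, q),
      (X (ws e.1) - X (ws e.2) : MvPolynomial (Fin n) ℚ) with hPdef
  have hP0 : (θ P).coeff 0 ≠ 0 := by
    rw [hPdef, map_prod, Polynomial.coeff_zero_prod, Finset.prod_ne_zero_iff]
    intro e he
    simp only [Finset.mem_erase, Finset.mem_filter, Finset.mem_univ, true_and] at he
    obtain ⟨k1, k2, k3, k4, k5⟩ := he
    have hcc : cc o p m q r (ws e.1) ≠ cc o p m q r (ws e.2) := by
      obtain ⟨x, y⟩ := e
      simp only at k1 k2 k3 k4 k5 ⊢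
      have five : ∀ x, (x = o ∨ x = p ∨ x = m ∨ x = q ∨ x = r) → cc o p m q r (ws x) = 0 := by
        have w1 := wo o op.ne om.ne oq.ne
        have w2 := wo r pr.ne' mr.ne' qr.ne'
        rintro x (rfl | rfl | rfl | rfl | rfl) <;> simp [cc, wp, wm, wq, w1, w2]
      have nfive : ∀ x, ¬ (x = o ∨ x = p ∨ x = m ∨ x = q ∨ x = r) →
          cc o p m q r (ws x) = (x : ℕ) + 1 := by
        intro x hx
        rw [wo x (by tauto) (by tauto) (by tauto)]
        unfold cc
        rw [if_neg hx]
      by_cases hx : x = o ∨ x = p ∨ x = m ∨ x = q ∨ x = r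
      · by_cases hy : y = o ∨ y = p ∨ y = m ∨ y = q ∨ y = r
        · exfalso
          have o1 := n1.trans mq
          have o2 := o1.trans qr
          rcases hx with rfl | rfl | rfl | rfl | rfl <;>
          rcases hy with rfl | rfl | rfl | rfl | rfl <;>
          first
          | (apply k5; simp only [co, cp, cm, cq, cr]; done)
          | (apply absurd k4; apply not_le.2; assumption)
          | (apply absurd k3; apply not_lt.2; apply le_of_lt; assumption)
          | exact k1 rfl
          | exact k2 rfl
        · rw [five x hx, nfive y hy]
          positivity
      · by_cases hy : y = o ∨ y = p ∨ y = m ∨ y = q ∨ y = r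
        · rw [five y hy, nfive x hx]
          positivity
        · rw [nfive x hx, nfive y hy]
          intro e
          have : (x : ℕ) = y := by exact_mod_cast add_right_cancel e
          exact k3.ne (Fin.ext this)
    rw [map_sub, hθ, theta_X, theta_X]
    simp only [Polynomial.coeff_sub, Polynomial.coeff_add, Polynomial.coeff_C_mul,
      Polynomial.coeff_X_zero, Polynomial.coeff_C_zero, mul_zero, add_zero]
    rw [← mul_sub, ← Polynomial.C_sub]
    apply mul_ne_zero
    · exact Polynomial.X_ne_zero
    · rw [Polynomial.C_ne_zero]; exact sub_ne_zero.2 hcc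
  have hθF : θ (F ws) = Polynomial.C (6 * Z ^ 2) * (Polynomial.X ^ 2 * θ P) := by
    rw [hFw]
    simp only [wp, wm, wq, map_mul, map_sub]
    have Tp : θ (X p) = Polynomial.C (Z * (-1)) * Polynomial.X := by
      rw [hθ, theta_X]; simp [cc, tt, op.ne']
    have Tm : θ (X m) = 0 := by
      rw [hθ, theta_X]; simp [cc, tt, om.ne', pm.ne']
    have Tq : θ (X q) = Polynomial.C (Z * 2) * Polynomial.X := by
      rw [hθ, theta_X]; simp [cc, tt, oq.ne', pq.ne', mq.ne']; exact Or.inl rfl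
    rw [Tp, Tm, Tq]
    simp only [map_mul, map_neg, map_one, map_pow, Polynomial.C_ofNat]
    ring
  rw [L0, hθF] at L1
  rw [Polynomial.coeff_C_mul, Polynomial.coeff_X_pow_mul' ] at L1
  simp at L1
  rcases L1 with L1 | L1
  · exact Polynomial.X_ne_zero L1
  · exact hP0 L1

end
end Lolli

namespace Lolli

variable {n : ℕ}

lemma lollipop_of_gen (hn : 2 ≤ n)
    (h : Fin n → Fin n) (hmono : Monotone h) (hhess : ∀ j, j ≤ h j)
    (hconn : ∀ j : Fin n, (j : ℕ) + 1 < n → (j : ℕ) + 1 ≤ (h j : ℕ)) (H : GenInDegTwoQ h) :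
    Lollipop h := by
  have h0 := hconn ⟨0, by omega⟩ (by simp; omega)
  simp only [zero_add] at h0
  obtain ⟨a, ha⟩ : ∃ a, (h ⟨0, by omega⟩ : ℕ) = a + 1 := ⟨_, (Nat.sub_add_cancel h0).symm⟩
  have han : a + 1 < n := ha ▸ (h ⟨0, by omega⟩).2
  have mono : ∀ i j : Fin n, (i : ℕ) ≤ j → (h i : ℕ) ≤ h j := fun i j hij => hmono hij
  have s1 : ∀ j : Fin n, (j : ℕ) ≤ a → (h j : ℕ) = a + 1 := by
    intro j hj
    by_contra hne
    have m1 := mono ⟨0, by omega⟩ j (Nat.zero_le _)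
    have hj2 : a + 2 ≤ (h j : ℕ) := by omega
    have hn2 := (h j).2
    have hj0 : (j : ℕ) ≠ 0 := by
      intro e
      have : j = ⟨0, by omega⟩ := Fin.ext e
      rw [this] at hne; exact hne ha
    have m2 := mono j ⟨a + 1, by omega⟩ (by simp; omega)
    refine not_gen_diamond (h := h) (i := ⟨0, by omega⟩) (j := j) (k := ⟨a + 1, by omega⟩)
      (l := ⟨a + 2, by omega⟩) ?_ ?_ ?_ ?_ ?_ ?_ ?_ ?_ H <;>
    simp only [Fin.lt_def, Fin.le_def] <;> omega
  have hex : ∃ j, a < j ∧ ∃ hj : j < n, (h ⟨j, hj⟩ : ℕ) = n - 1 := by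
    refine ⟨n - 1, by omega, by omega, ?_⟩
    have := hhess ⟨n - 1, by omega⟩
    simp only [Fin.le_def] at this
    have h2 := (h ⟨n - 1, by omega⟩).2
    omega
  classical
  set b := Nat.find hex with hb
  obtain ⟨hab, hbn, hhb⟩ := Nat.find_spec hex
  have hmin : ∀ j, j < b → a < j → ∀ hj : j < n, (h ⟨j, hj⟩ : ℕ) ≠ n - 1 := by
    intro j hjb haj hj e
    exact Nat.find_min hex hjb ⟨haj, hj, e⟩
  rw [← hb] at hab hbn
  have s2 : ∀ j : ℕ, a < j → j < b → ∀ hj : j < n, (h ⟨j, hj⟩ : ℕ) = j + 1 := by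
    intro j
    induction j with
    | zero => intro h1; omega
    | succ j ih =>
      intro h1 h2 hj
      have hprev : (h ⟨j, by omega⟩ : ℕ) = j + 1 := by
        rcases Nat.lt_or_ge a j with h3 | h3
        · exact ih h3 (by omega) _
        · rw [s1 _ (by simpa using h3)]; omega
      by_contra hne
      have k1 := hconn ⟨j + 1, hj⟩ (by simp; omega)
      simp only at k1
      have k2 := hmin (j + 1) h2 h1 hj
      have k3 := (h ⟨j + 1, hj⟩).2
      have k4 := hconn (h ⟨j + 1, hj⟩) (by omega)
      refine not_gen_bull (h := h) hmono (o := ⟨j, by omega⟩) (p := ⟨j + 1, hj⟩)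
        (m := ⟨j + 2, by omega⟩) (q := h ⟨j + 1, hj⟩) (r := ⟨h ⟨j + 1, hj⟩ + 1, by omega⟩)
        ?_ ?_ ?_ ?_ ?_ ?_ ?_ ?_ ?_ H <;>
      simp only [Fin.lt_def, Fin.le_def] <;> omega
  refine ⟨a, b, hab, by omega, s1, fun j h1 h2 => s2 j h1 h2 j.2, fun j hj => ?_⟩
  have := mono ⟨b, hbn⟩ j hj
  have h2 := (h j).2
  have h3 : (h ⟨b, hbn⟩ : ℕ) = n - 1 := hhb
  omega

end Lolli

namespace Lolli

variable {n : ℕ}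

lemma gkm_mul {h : Fin n → Fin n} {f g : Fun n} (hf : InGKMQ h f) (hg : InGKMQ h g) :
    InGKMQ h (f * g) := by
  intro w i j hji hi
  have e : (f * g) w - (f * g) (w * Equiv.swap i j) =
      (f w - f (w * Equiv.swap i j)) * g w +
      f (w * Equiv.swap i j) * (g w - g (w * Equiv.swap i j)) := by
    simp only [Pi.mul_apply]; ring
  rw [e]
  exact Ideal.add_mem _ (Ideal.mul_mem_right _ _ (hf w i j hji hi))
    (Ideal.mul_mem_left _ _ (hg w i j hji hi))

lemma gkm_add {h : Fin n → Fin n} {f g : Fun n} (hf : InGKMQ h f) (hg : InGKMQ h g) :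
    InGKMQ h (f + g) := by
  intro w i j hji hi
  have e : (f + g) w - (f + g) (w * Equiv.swap i j) =
      (f w - f (w * Equiv.swap i j)) + (g w - g (w * Equiv.swap i j)) := by
    simp only [Pi.add_apply]; ring
  rw [e]
  exact Ideal.add_mem _ (hf w i j hji hi) (hg w i j hji hi)

lemma gkm_const (h : Fin n → Fin n) (q : MvPolynomial (Fin n) ℚ) :
    InGKMQ h (fun _ => q) := by
  intro w i j hji hi
  simp

lemma gkm_of_gen {h : Fin n → Fin n} {g : Fun n} (hg : g ∈ Gen2 h) : InGKMQ h g := by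
  induction hg using Algebra.adjoin_induction with
  | mem x hx => exact hx.1
  | algebraMap a => exact gkm_const h _
  | add x y _ _ hx hy => exact gkm_add hx hy
  | mul x y _ _ hx hy => exact gkm_mul hx hy

lemma X_sub_ne {a b : Fin n} (hab : a ≠ b) : (X a - X b : MvPolynomial (Fin n) ℚ) ≠ 0 := by
  intro h0; exact hab (X_injective (sub_eq_zero.1 h0))

lemma X_sub_irr {a b : Fin n} (hab : a ≠ b) : Irreducible (X a - X b : MvPolynomial (Fin n) ℚ) := by
  have hne := X_sub_ne hab
  have hdeg : (X a - X b : MvPolynomial (Fin n) ℚ).totalDegree = 1 :=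
    ((isHomogeneous_X ℚ a).sub (isHomogeneous_X ℚ b)).totalDegree hne
  have unit0 : ∀ p : MvPolynomial (Fin n) ℚ, p ≠ 0 → p.totalDegree = 0 → IsUnit p := by
    intro p hp h0
    rw [totalDegree_eq_zero_iff_eq_C] at h0
    rw [h0] at hp ⊢
    exact (isUnit_iff_ne_zero.2 (fun e => hp (by rw [e, C_0]))).map C
  constructor
  · intro hu
    obtain ⟨q, hq⟩ := hu.exists_right_inv
    have := congrArg (MvPolynomial.eval (fun _ => (0 : ℚ))) hq
    simp at this
  · intro p q hpq
    have hp : p ≠ 0 := by rintro rfl; simp at hpq; exact hne hpq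
    have hq : q ≠ 0 := by rintro rfl; simp at hpq; exact hne hpq
    rw [hpq, totalDegree_mul_of_isDomain hp hq] at hdeg
    rcases Nat.eq_zero_or_pos p.totalDegree with h0 | h0
    · exact Or.inl (unit0 p hp h0)
    · exact Or.inr (unit0 q hq (by omega))

lemma X_sub_not_dvd {a b c d : Fin n} (hba : b < a) (hdc : d < c)
    (hne : ¬ (a = c ∧ b = d)) :
    ¬ (X a - X b : MvPolynomial (Fin n) ℚ) ∣ X c - X d := by
  rintro ⟨q, hq⟩
  have := congrArg (MvPolynomial.eval (fun v : Fin n => if v = a then (0 : ℚ) else if v = b then 0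
    else (v : ℕ) + 1)) hq
  simp only [map_sub, map_mul, eval_X] at this
  simp only [if_true, hba.ne, if_false, sub_self, zero_mul] at this
  have pos : ∀ v : Fin n, (v : ℚ) + 1 ≠ 0 := fun v => by positivity
  have hcd : (c : ℕ) ≠ d := fun e => hdc.ne' (Fin.ext e)
  have : (if c = a then (0 : ℚ) else if c = b then 0 else ((c : ℕ) : ℚ) + 1)
    = (if d = a then (0 : ℚ) else if d = b then 0 else ((d : ℕ) : ℚ) + 1) := sub_eq_zero.1 this
  split_ifs at this with h1 h2 h3 h4 h5 h6 h7
  all_goals first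
    | (exfalso; exact pos _ this)
    | (exfalso; exact pos _ this.symm)
    | (exfalso; apply hcd; exact_mod_cast add_right_cancel this)
    | skip
  · subst h1 h2; exact lt_irrefl _ hdc
  · exact hne ⟨h1.symm, h3.symm⟩
  · subst h4 h5; exact lt_asymm hba hdc
  · subst h4; exact hdc.ne h6

/-- the inverted edges -/
def inv (h : Fin n → Fin n) (w : Equiv.Perm (Fin n)) : Finset (Fin n × Fin n) :=
  Finset.univ.filter (fun e => e.1 < e.2 ∧ e.2 ≤ h e.1 ∧ w e.2 < w e.1)

lemma prod_dvd {h : Fin n → Fin n} {f : Fun n} (hf : InGKMQ h f) (w : Equiv.Perm (Fin n))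
    (hz : ∀ i j : Fin n, i < j → j ≤ h i → w j < w i → f (w * Equiv.swap i j) = 0) :
    ∏ e ∈ inv h w, (X (w e.1) - X (w e.2)) ∣ f w := by
  apply Finset.prod_dvd_of_isRelPrime
  · intro e he e' he' hne
    simp only [inv, Finset.coe_filter, Finset.mem_univ, true_and, Set.mem_setOf_eq] at he he'
    simp only [Function.onFun]
    rw [(X_sub_irr he.2.2.ne').isRelPrime_iff_not_dvd]
    apply X_sub_not_dvd he.2.2 he'.2.2
    rintro ⟨h1, h2⟩
    exact hne (Prod.ext (w.injective h1) (w.injective h2))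
  · intro e he
    simp only [inv, Finset.mem_filter, Finset.mem_univ, true_and] at he
    have := hf w e.2 e.1 he.1 he.2.1
    rw [Equiv.swap_comm, hz e.1 e.2 he.1 he.2.1 he.2.2, sub_zero, Ideal.mem_span_singleton] at this
    rw [← neg_sub]
    exact neg_dvd.2 this

lemma tri {h : Fin n → Fin n} {L : Type*} [LinearOrder L] (ρ : Equiv.Perm (Fin n) → L)
    (G : Equiv.Perm (Fin n) → Fun n) (hG : ∀ w, G w ∈ Gen2 h)
    (hG1 : ∀ w, G w w = ∏ e ∈ inv h w, (X (w e.1) - X (w e.2)))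
    (hG2 : ∀ w u, G w u ≠ 0 → u = w ∨ ρ w < ρ u)
    (hρ : ∀ w i j, i < j → j ≤ h i → w j < w i → ρ (w * Equiv.swap i j) < ρ w)
    (f : Fun n) (hf : InGKMQ h f) : f ∈ Gen2 h := by
  suffices main : ∀ (k : ℕ) (s : Finset (Equiv.Perm (Fin n))), s.card = k →
      (∀ u ∈ s, ∀ v, ρ u < ρ v → v ∈ s) → ∀ f : Fun n, InGKMQ h f → (∀ u, u ∉ s → f u = 0) →
      f ∈ Gen2 h from main _ Finset.univ rfl (by simp) f hf (by simp)
  intro k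
  induction k with
  | zero =>
    intro s hs _ f _ hz
    rw [Finset.card_eq_zero] at hs
    subst hs
    have : f = 0 := funext fun u => hz u (by simp)
    rw [this]; exact Subalgebra.zero_mem _
  | succ k ih =>
    intro s hs hup f hf hz
    obtain ⟨w, hw, hmin⟩ := s.exists_min_image ρ (Finset.card_pos.1 (by omega))
    obtain ⟨q, hq⟩ := prod_dvd hf w (fun i j hij hj hinv => hz _ (fun hmem =>
      absurd (hmin _ hmem) (not_le.2 (hρ w i j hij hj hinv))))
    have hqG : (fun _ => q : Fun n) * G w ∈ Gen2 h := (Gen2 h).mul_mem (const_mem h q) (hG w)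
    have hf' : InGKMQ h (f + (fun _ => -1 : Fun n) * ((fun _ => q : Fun n) * G w)) :=
      gkm_add hf (gkm_mul (gkm_const h _) (gkm_of_gen hqG))
    have := ih (s.erase w) (by rw [Finset.card_erase_of_mem hw]; omega) ?_ _ hf' ?_
    · have h2 := (Gen2 h).add_mem this hqG
      convert h2 using 1
      funext u; simp
    · intro u hu v huv
      rw [Finset.mem_erase] at hu ⊢
      refine ⟨?_, hup u hu.2 v huv⟩
      rintro rfl
      exact absurd (hmin u hu.2) (not_le.2 huv)
    · intro u hu
      rw [Finset.mem_erase, not_and_or, not_not] at hu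
      rcases eq_or_ne u w with rfl | hne
      · simp only [Pi.add_apply, Pi.mul_apply, hG1]
        rw [hq]; ring
      · have hus : u ∉ s := hu.resolve_left hne
        have : G w u = 0 := by
          by_contra h0
          rcases hG2 w u h0 with h1 | h1
          · exact hne h1
          · exact hus (hup w hw u h1)
        simp [this, hz u hus]

end Lolli

namespace Lolli

variable {n : ℕ}

/-- edges of a lollipop graph with cut vertices `c ≤ b` -/
structure LP (h : Fin n → Fin n) (c b : Fin n) : Prop where
  le : c ≤ b
  edge : ∀ i j, i < j → (j ≤ h i ↔ (i < c ∧ j ≤ c) ∨ (c ≤ i ∧ i < b ∧ (j : ℕ) = i + 1) ∨ b ≤ i)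

open Classical in
noncomputable def phi (c b : Fin n) (w : Equiv.Perm (Fin n)) (i j : Fin n) : Fun n := fun u =>
  if j < c ∨ b < i then X (u i) - X (w j)
  else if j = c then (if u.symm (w i) < c then X (w i) - X (u c) else 0)
  else if i = b then (if b < u.symm (w j) then X (u b) - X (w j) else 0)
  else (if ∀ x ≤ i, w.symm (u x) ≤ i then X (u i) - X (u j) else 0)

lemma hom_sub (a b : Fin n) : (X a - X b : MvPolynomial (Fin n) ℚ).IsHomogeneous 1 :=
  (isHomogeneous_X ℚ a).sub (isHomogeneous_X ℚ b)

lemma hom_ite (P : Prop) [Decidable P] (a b : Fin n) :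
    (if P then X a - X b else 0 : MvPolynomial (Fin n) ℚ).IsHomogeneous 1 := by
  split_ifs
  · exact hom_sub a b
  · exact isHomogeneous_zero _ _ _

lemma span_refl {u : Equiv.Perm (Fin n)} {i j : Fin n} :
    (X (u j) - X (u i) : MvPolynomial (Fin n) ℚ) ∈
      Ideal.span {(X (u i) - X (u j) : MvPolynomial (Fin n) ℚ)} := by
  rw [Ideal.mem_span_singleton, ← neg_sub]
  exact neg_dvd.2 dvd_rfl |>.trans (by simp)

lemma phi_mem {h : Fin n → Fin n} {c b : Fin n} (H : LP h c b) (w : Equiv.Perm (Fin n))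
    (i j : Fin n) (hij : i < j) (hj : j ≤ h i) : phi c b w i j ∈ Gen2 h := by
  classical
  apply Algebra.subset_adjoin
  have hcb := H.le
  have he := (H.edge i j hij).1 hj
  by_cases h1 : j < c ∨ b < i
  · have : phi c b w i j = fun u => X (u i) - X (w j) := by
      funext u; simp only [phi, if_pos h1]
    rw [this]
    refine ⟨fun u x y hyx hx => ?_, fun u => hom_sub _ _⟩
    have := X_swap_mem u x y i
    simpa using this
  by_cases h2 : j = c
  · have : phi c b w i j = fun u => if u.symm (w i) < c then X (w i) - X (u c) else 0 := by
      funext u; simp only [phi, if_neg h1, if_pos h2]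
    rw [this]
    refine ⟨fun u x y hyx hx => ?_, fun u => hom_ite _ _ _⟩
    apply gkm_ite
    · have := neg_mem (X_swap_mem u x y c)
      convert this using 1
      ring
    · intro hP
      have e1 : (u * Equiv.swap x y).symm (w i) = Equiv.swap x y (u.symm (w i)) := by
        rw [Equiv.symm_apply_eq]; simp
      rw [e1] at hP
      have hxy := (H.edge y x hyx).1 hx
      obtain ⟨k, hk⟩ : ∃ k, w i = u k := ⟨u.symm (w i), by simp⟩
      rw [hk] at hP ⊢
      simp only [Equiv.symm_apply_apply] at hP
      by_cases k1 : k = x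
      · subst k1
        rw [Equiv.swap_apply_left] at hP
        have : k = c := by
          simp only [Fin.lt_def, Fin.le_def, Fin.ext_iff] at *; omega
        subst this; simp
      by_cases k2 : k = y
      · subst k2
        rw [Equiv.swap_apply_right] at hP
        have : x = c := by
          simp only [Fin.lt_def, Fin.le_def, Fin.ext_iff] at *; omega
        subst this; exact span_refl
      · rw [Equiv.swap_apply_of_ne_of_ne k1 k2] at hP; exact absurd Iff.rfl hP
  by_cases h3 : i = b
  · have : phi c b w i j = fun u => if b < u.symm (w j) then X (u b) - X (w j) else 0 := by
      funext u; simp only [phi, if_neg h1, if_neg h2, if_pos h3]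
    rw [this]
    refine ⟨fun u x y hyx hx => ?_, fun u => hom_ite _ _ _⟩
    apply gkm_ite
    · have := X_swap_mem u x y b
      convert this using 1
      ring
    · intro hP
      have e1 : (u * Equiv.swap x y).symm (w j) = Equiv.swap x y (u.symm (w j)) := by
        rw [Equiv.symm_apply_eq]; simp
      rw [e1] at hP
      have hxy := (H.edge y x hyx).1 hx
      obtain ⟨k, hk⟩ : ∃ k, w j = u k := ⟨u.symm (w j), by simp⟩
      rw [hk] at hP ⊢
      simp only [Equiv.symm_apply_apply] at hP
      by_cases k1 : k = x
      · subst k1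
        rw [Equiv.swap_apply_left] at hP
        have : y = b := by
          simp only [Fin.lt_def, Fin.le_def, Fin.ext_iff] at *; omega
        subst this; exact span_refl
      by_cases k2 : k = y
      · subst k2
        rw [Equiv.swap_apply_right] at hP
        have : k = b := by
          simp only [Fin.lt_def, Fin.le_def, Fin.ext_iff] at *; omega
        subst this; simp
      · rw [Equiv.swap_apply_of_ne_of_ne k1 k2] at hP; exact absurd Iff.rfl hP
  · have : phi c b w i j = fun u => if ∀ x ≤ i, w.symm (u x) ≤ i then X (u i) - X (u j) else 0 := by
      funext u; simp only [phi, if_neg h1, if_neg h2, if_neg h3]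
    rw [this]
    have hh : c ≤ i ∧ i < b ∧ (j : ℕ) = i + 1 := by
      simp only [Fin.lt_def, Fin.le_def, Fin.ext_iff] at *; omega
    refine ⟨fun u x y hyx hx => ?_, fun u => hom_ite _ _ _⟩
    have hxy := (H.edge y x hyx).1 hx
    apply gkm_ite
    · have := sub_mem (X_swap_mem u x y i) (X_swap_mem u x y j)
      convert this using 1
      ring
    · intro hP
      have key : y = i ∧ x = j := by
        by_contra hne
        apply hP
        have hyxi : (y ≤ i ↔ x ≤ i) := by
          simp only [Fin.lt_def, Fin.le_def, Fin.ext_iff] at *; omega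
        have kk : ∀ u : Equiv.Perm (Fin n), (∀ z ≤ i, w.symm (u z) ≤ i) →
            ∀ z ≤ i, w.symm ((u * Equiv.swap x y) z) ≤ i := by
          intro u hu z hz
          apply hu
          by_cases k1 : z = x
          · subst k1; rw [Equiv.swap_apply_left]; exact hyxi.2 hz
          by_cases k2 : z = y
          · subst k2; rw [Equiv.swap_apply_right]; exact hyxi.1 hz
          · rwa [Equiv.swap_apply_of_ne_of_ne k1 k2]
        refine ⟨kk u, fun h' => ?_⟩
        simpa [mul_assoc] using kk _ h'
      rw [key.1, key.2]
      exact span_refl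

lemma phi_self {c b : Fin n} (w : Equiv.Perm (Fin n)) (i j : Fin n) (hij : i < j) :
    phi c b w i j w = X (w i) - X (w j) := by
  classical
  unfold phi
  split_ifs with h1 h2 h3 h4 h5 h6 h7
  · rfl
  · rw [h2]
  · exact absurd (by simpa [h2] using hij) h3
  · rw [h4]
  · exact absurd (by simpa [h4] using hij) h5
  · rfl
  · exact absurd (by simp) h6

noncomputable def GG (h : Fin n → Fin n) (c b : Fin n) (w : Equiv.Perm (Fin n)) : Fun n :=
  ∏ e ∈ inv h w, phi c b w e.1 e.2

lemma GG_mem {h : Fin n → Fin n} {c b : Fin n} (H : LP h c b) (w : Equiv.Perm (Fin n)) :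
    GG h c b w ∈ Gen2 h := by
  apply Subalgebra.prod_mem
  intro e he
  simp only [inv, Finset.mem_filter, Finset.mem_univ, true_and] at he
  exact phi_mem H w e.1 e.2 he.1 he.2.1

lemma GG_self {h : Fin n → Fin n} {c b : Fin n} (w : Equiv.Perm (Fin n)) :
    GG h c b w w = ∏ e ∈ inv h w, (X (w e.1) - X (w e.2)) := by
  rw [GG, Finset.prod_apply]
  refine Finset.prod_congr rfl fun e he => ?_
  simp only [inv, Finset.mem_filter, Finset.mem_univ, true_and] at he
  exact phi_self w e.1 e.2 he.1

/-- the combinatorial support facts -/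
structure Supp (c b : Fin n) (w u : Equiv.Perm (Fin n)) : Prop where
  s1 : ∀ i j, i < j → j < c → w j < w i → u i ≠ w j
  s1' : ∀ i j, i < j → b < i → w j < w i → u i ≠ w j
  s2 : ∀ i, i < c → w c < w i → u.symm (w i) < c
  s3 : ∀ j, b < j → w j < w b → b < u.symm (w j)
  s4 : ∀ k k' : Fin n, c ≤ k → k < b → (k' : ℕ) = k + 1 → w k' < w k → ∀ x ≤ k, w.symm (u x) ≤ k

lemma GG_supp {h : Fin n → Fin n} {c b : Fin n} (H : LP h c b) (w u : Equiv.Perm (Fin n))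
    (hne : GG h c b w u ≠ 0) : Supp c b w u := by
  classical
  have hcb := H.le
  have key : ∀ i j, i < j → ((i < c ∧ j ≤ c) ∨ (c ≤ i ∧ i < b ∧ (j : ℕ) = i + 1) ∨ b ≤ i) →
      w j < w i → phi c b w i j u ≠ 0 := by
    intro i j hij he hw
    rw [GG, Finset.prod_apply, Finset.prod_ne_zero_iff] at hne
    exact hne (i, j) (by simp [inv, hij, (H.edge i j hij).2 he, hw])
  constructor
  · intro i j hij hj hw
    have := key i j hij (Or.inl ⟨hij.trans hj, hj.le⟩) hw
    rw [phi, if_pos (Or.inl hj)] at this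
    intro e; rw [e, sub_self] at this; exact this rfl
  · intro i j hij hj hw
    have := key i j hij (Or.inr (Or.inr hj.le)) hw
    rw [phi, if_pos (Or.inr hj)] at this
    intro e; rw [e, sub_self] at this; exact this rfl
  · intro i hi hw
    have := key i c hi (Or.inl ⟨hi, le_rfl⟩) hw
    rw [phi, if_neg (by rintro (h1 | h1); exact lt_irrefl _ h1; exact absurd (h1.trans hi) (not_lt.2 hcb)),
      if_pos rfl] at this
    by_contra h0
    rw [if_neg h0] at this; exact this rfl
  · intro j hj hw
    have := key b j hj (Or.inr (Or.inr le_rfl)) hw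
    have hcj := hcb.trans_lt hj
    rw [phi, if_neg (by rintro (h1 | h1); exact lt_asymm h1 hcj; exact lt_irrefl _ h1),
      if_neg hcj.ne', if_pos rfl] at this
    by_contra h0
    rw [if_neg h0] at this; exact this rfl
  · intro k k' hk hkb hk' hw
    have hlt : k < k' := by rw [Fin.lt_def]; omega
    have := key k k' hlt (Or.inr (Or.inl ⟨hk, hkb, hk'⟩)) hw
    rw [phi, if_neg (by simp only [Fin.lt_def, Fin.le_def] at *; omega),
      if_neg (hk.trans_lt hlt).ne', if_neg hkb.ne] at this
    by_contra h0
    rw [if_neg h0] at this; exact this rfl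

end Lolli

namespace Lolli

variable {n : ℕ}

lemma descent (w : Equiv.Perm (Fin n)) (i j : Fin n) (hij : i < j) (hw : w j < w i) :
    ∃ k k' : Fin n, i ≤ k ∧ k < j ∧ (k' : ℕ) = k + 1 ∧ w k' < w k := by
  by_contra hno
  push Not at hno
  have : ∀ d : ℕ, ∀ hd : (i : ℕ) + d < n, (i : ℕ) + d ≤ j → w i ≤ w ⟨i + d, hd⟩ := by
    intro d
    induction d with
    | zero => intro hd _; exact le_rfl
    | succ d ih =>
      intro hd hle
      refine (ih (by omega) (by omega)).trans
        (hno ⟨i + d, by omega⟩ ⟨i + (d + 1), hd⟩ ?_ ?_ ?_)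
      · simp [Fin.le_def]
      · simp [Fin.lt_def]; omega
      · simp; omega
  have h2 := this (j - i) (by have := j.2; simp only [Fin.lt_def] at hij; omega)
    (by simp only [Fin.lt_def] at hij; omega)
  have h3 : (⟨(i : ℕ) + (j - i), by have := j.2; simp only [Fin.lt_def] at hij; omega⟩ : Fin n) = j := by
    simp only [Fin.lt_def] at hij; ext; simp; omega
  rw [h3] at h2
  exact absurd hw (not_lt.2 h2)

lemma maps_inv (w u : Equiv.Perm (Fin n)) (T : Finset (Fin n)) (H : ∀ x ∈ T, w.symm (u x) ∈ T) :
    ∀ x ∈ T, u.symm (w x) ∈ T := by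
  intro x hx
  obtain ⟨y, hy, e⟩ := Finset.surj_on_of_inj_on_of_card_le (s := T) (t := T)
    (fun x _ => w.symm (u x)) H (fun a b _ _ e => u.injective (w.symm.injective e)) le_rfl x hx
  rw [e]; simpa using hy

lemma sum_lemma (W U : Finset (Fin n)) (hc : W.card = U.card) (θ : ℕ)
    (hnew : ∀ x ∈ U, x ∉ W → θ ≤ (x : ℕ)) (hlost : ∀ x ∈ W, x ∉ U → (x : ℕ) < θ) :
    ∑ x ∈ W, (x : ℕ) + (U \ W).card ≤ ∑ x ∈ U, (x : ℕ) := by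
  have e1 := Finset.sum_inter_add_sum_sdiff W U (fun x => (x : ℕ))
  have e2 := Finset.sum_inter_add_sum_sdiff U W (fun x => (x : ℕ))
  rw [Finset.inter_comm] at e2
  have c1 := Finset.card_inter_add_card_sdiff W U
  have c2 := Finset.card_inter_add_card_sdiff U W
  rw [Finset.inter_comm] at c2
  have hcc : (W \ U).card = (U \ W).card := by omega
  have l1 : ∑ x ∈ W \ U, ((x : ℕ) + 1) ≤ (W \ U).card • θ :=
    Finset.sum_le_card_nsmul _ _ _ fun x hx => by
      rw [Finset.mem_sdiff] at hx; exact hlost x hx.1 hx.2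
  have l2 : (U \ W).card • θ ≤ ∑ x ∈ U \ W, (x : ℕ) :=
    Finset.card_nsmul_le_sum _ _ _ fun x hx => by
      rw [Finset.mem_sdiff] at hx; exact hnew x hx.1 hx.2
  rw [Finset.sum_add_distrib, hcc] at l1
  simp only [Finset.sum_const, smul_eq_mul, mul_one] at l1 l2
  omega

/-- weight of a word on an initial segment -/
def wt (T : Finset (Fin n)) (u : Equiv.Perm (Fin n)) : ℕ := ∑ x ∈ T, (u x : ℕ)

lemma wt_lemma (w u : Equiv.Perm (Fin n)) (T : Finset (Fin n)) (θ : ℕ)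
    (hnew : ∀ x ∈ T, w.symm (u x) ∉ T → θ ≤ (u x : ℕ))
    (hlost : ∀ x ∈ T, u.symm (w x) ∉ T → (w x : ℕ) < θ) :
    wt T w < wt T u ∨ (wt T w = wt T u ∧ ∀ x ∈ T, w.symm (u x) ∈ T) := by
  have hm : ∀ (v : Equiv.Perm (Fin n)) (y : Fin n), y ∈ T.map v.toEmbedding ↔ v.symm y ∈ T := by
    intro v y
    simp only [Finset.mem_map, Equiv.coe_toEmbedding]
    constructor
    · rintro ⟨x, hx, rfl⟩; simpa using hx
    · intro hy; exact ⟨_, hy, by simp⟩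
  have hs : ∀ v : Equiv.Perm (Fin n), wt T v = ∑ x ∈ T.map v.toEmbedding, (x : ℕ) := by
    intro v; simp [wt]
  have key := sum_lemma (T.map w.toEmbedding) (T.map u.toEmbedding) (by simp) θ
    (by
      intro y hy hy'
      rw [hm] at hy hy'
      simpa using hnew _ hy (by simpa using hy'))
    (by
      intro y hy hy'
      rw [hm] at hy hy'
      simpa using hlost _ hy (by simpa using hy'))
  rw [← hs, ← hs] at key
  rcases Nat.eq_zero_or_pos (T.map u.toEmbedding \ T.map w.toEmbedding).card with h0 | h0
  · rw [h0] at key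
    rcases Nat.lt_or_ge (wt T w) (wt T u) with h1 | h1
    · exact Or.inl h1
    · refine Or.inr ⟨by omega, fun x hx => ?_⟩
      rw [Finset.card_eq_zero, Finset.sdiff_eq_empty_iff_subset] at h0
      have := h0 ((hm u (u x)).2 (by simpa using hx))
      rwa [hm] at this
  · left; omega

noncomputable def rho (c b : Fin n) (u : Equiv.Perm (Fin n)) : ℕ ×ₗ ℕ ×ₗ Lex (Fin n → Fin n) :=
  toLex (wt (Finset.univ.filter (· < c)) u, toLex (wt (Finset.univ.filter (· ≤ b)) u,
    toLex (u : Fin n → Fin n)))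

lemma rho_lt {c b : Fin n} (w u : Equiv.Perm (Fin n))
    (hA : wt (Finset.univ.filter (· < c)) w ≤ wt (Finset.univ.filter (· < c)) u)
    (hB : wt (Finset.univ.filter (· < c)) w = wt (Finset.univ.filter (· < c)) u →
      wt (Finset.univ.filter (· ≤ b)) w ≤ wt (Finset.univ.filter (· ≤ b)) u)
    (hC : wt (Finset.univ.filter (· < c)) w = wt (Finset.univ.filter (· < c)) u →
      wt (Finset.univ.filter (· ≤ b)) w = wt (Finset.univ.filter (· ≤ b)) u →
      ∃ p, (∀ x < p, w x = u x) ∧ w p < u p) : rho c b w < rho c b u := by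
  unfold rho
  rw [Prod.Lex.toLex_lt_toLex]
  rcases hA.lt_or_eq with h1 | h1
  · exact Or.inl h1
  · refine Or.inr ⟨h1, ?_⟩
    simp only
    rw [Prod.Lex.toLex_lt_toLex]
    rcases (hB h1).lt_or_eq with h2 | h2
    · exact Or.inl h2
    · refine Or.inr ⟨h2, ?_⟩
      obtain ⟨p, hp, hp'⟩ := hC h1 h2
      exact ⟨p, hp, hp'⟩

lemma wt_swap (T : Finset (Fin n)) (hT : ∀ x y, x ≤ y → y ∈ T → x ∈ T) (w : Equiv.Perm (Fin n))
    (i j : Fin n) (hij : i < j) (hw : w j < w i) : wt T (w * Equiv.swap i j) ≤ wt T w := by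
  unfold wt
  by_cases hj : j ∈ T
  · have hi := hT i j hij.le hj
    apply le_of_eq
    refine Finset.sum_equiv (Equiv.swap i j) (fun x => ?_) (fun x _ => by simp)
    by_cases h1 : x = i
    · subst h1; simp [hi, hj]
    by_cases h2 : x = j
    · subst h2; simp [hi, hj]
    · rw [Equiv.swap_apply_of_ne_of_ne h1 h2]
  · refine Finset.sum_le_sum fun x hx => ?_
    have h2 : x ≠ j := by rintro rfl; exact hj hx
    by_cases h1 : x = i
    · subst h1; simpa using hw.le
    · rw [Equiv.Perm.mul_apply, Equiv.swap_apply_of_ne_of_ne h1 h2]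

lemma rho_swap (c b : Fin n) (w : Equiv.Perm (Fin n)) (i j : Fin n) (hij : i < j)
    (hw : w j < w i) : rho c b (w * Equiv.swap i j) < rho c b w := by
  apply rho_lt
  · refine wt_swap _ ?_ w i j hij hw
    intro x y hxy; simp only [Finset.mem_filter, Finset.mem_univ, true_and]
    exact hxy.trans_lt
  · intro _
    refine wt_swap _ ?_ w i j hij hw
    intro x y hxy; simp only [Finset.mem_filter, Finset.mem_univ, true_and]
    exact hxy.trans
  · intro _ _
    refine ⟨i, fun x hx => ?_, by simpa using hw⟩
    rw [Equiv.Perm.mul_apply, Equiv.swap_apply_of_ne_of_ne hx.ne (hx.trans hij).ne]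

lemma supp_rho {c b : Fin n} (hcb : c ≤ b) {w u : Equiv.Perm (Fin n)} (S : Supp c b w u) :
    u = w ∨ rho c b w < rho c b u := by
  have F1 := wt_lemma w u (Finset.univ.filter (· < c)) (w c : ℕ) (by
      simp only [Finset.mem_filter, Finset.mem_univ, true_and, not_lt]
      intro x hx hy
      obtain ⟨y, hy'⟩ : ∃ y, u x = w y := ⟨w.symm (u x), by simp⟩
      rw [hy'] at hy ⊢
      simp only [Equiv.symm_apply_apply] at hy
      by_contra hlt
      have hlt : w y < w c := not_le.1 hlt
      have hcy : c < y := lt_of_le_of_ne hy (by rintro rfl; exact lt_irrefl _ hlt)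
      have nod : ∀ z, c < z → z ≤ b → z ≤ y → ¬ w z < w c := by
        intro z hcz hzb hzy hwz
        obtain ⟨k, k', h1, h2, h3, h4⟩ := descent w c z hcz hwz
        have := S.s4 k k' h1 (h2.trans_le hzb) h3 h4 x (hx.le.trans h1)
        rw [hy'] at this
        simp only [Equiv.symm_apply_apply] at this
        exact absurd (this.trans_lt h2) (not_lt.2 hzy)
      rcases le_or_gt y b with hyb | hyb
      · exact nod y hcy hyb le_rfl hlt
      · rcases lt_or_ge (w y) (w b) with h1 | h1
        · have := S.s3 y hyb h1
          rw [← hy'] at this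
          simp only [Equiv.symm_apply_apply] at this
          exact absurd (this.trans hx) (not_lt.2 hcb)
        · have hwb := h1.trans_lt hlt
          exact nod b (lt_of_le_of_ne hcb (by rintro rfl; exact lt_irrefl _ hwb)) le_rfl hyb.le hwb)
    (by
      simp only [Finset.mem_filter, Finset.mem_univ, true_and, not_lt]
      intro x hx hy
      have : w x ≠ w c := fun e => hx.ne (w.injective e)
      rcases lt_or_ge (w c) (w x) with h1 | h1
      · exact absurd (S.s2 x hx h1) (not_lt.2 hy)
      · exact Fin.lt_def.1 (lt_of_le_of_ne h1 this))
  rcases F1 with F1 | ⟨F1, G1⟩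
  · exact Or.inr (rho_lt w u F1.le (fun e => absurd e F1.ne) (fun e => absurd e F1.ne))
  have G1' := maps_inv w u _ G1
  simp only [Finset.mem_filter, Finset.mem_univ, true_and] at G1 G1'
  have F2 := wt_lemma w u (Finset.univ.filter (· ≤ b)) ((w b : ℕ) + 1) (by
      simp only [Finset.mem_filter, Finset.mem_univ, true_and, not_le]
      intro x hx hy
      obtain ⟨y, hy'⟩ : ∃ y, u x = w y := ⟨w.symm (u x), by simp⟩
      rw [hy'] at hy ⊢
      simp only [Equiv.symm_apply_apply] at hy
      by_contra hlt
      have hlt : w y ≤ w b := by rw [Fin.le_def]; omega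
      have hlt := lt_of_le_of_ne hlt (fun e => hy.ne' (w.injective e))
      have := S.s3 y hy hlt
      rw [← hy'] at this
      simp only [Equiv.symm_apply_apply] at this
      exact absurd this (not_lt.2 hx))
    (by
      simp only [Finset.mem_filter, Finset.mem_univ, true_and, not_le]
      intro x hx hy
      by_contra hlt
      have hlt : w b < w x := by rw [Fin.lt_def]; omega
      rcases lt_or_ge x c with h1 | h1
      · exact absurd (hy.trans (G1' x h1)) (not_lt.2 hcb)
      · have hxb := lt_of_le_of_ne hx (by rintro rfl; exact lt_irrefl _ hlt)
        obtain ⟨k, k', h3, h4, h5, h6⟩ := descent w x b hxb hlt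
        have s4 := S.s4 k k' (h1.trans h3) h4 h5 h6
        have := maps_inv w u (Finset.univ.filter (· ≤ k)) (by simpa using s4) x (by simpa using h3)
        simp only [Finset.mem_filter, Finset.mem_univ, true_and] at this
        exact absurd (hy.trans_le this) (not_lt.2 h4.le))
  rcases F2 with F2 | ⟨F2, G2⟩
  · exact Or.inr (rho_lt w u F1.le (fun _ => F2.le) (fun _ e => absurd e F2.ne))
  simp only [Finset.mem_filter, Finset.mem_univ, true_and] at G2
  by_cases huw : u = w
  · exact Or.inl huw
  right
  apply rho_lt w u F1.le (fun _ => F2.le)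
  intro _ _
  have hex : ∃ p : ℕ, ∃ hp : p < n, w ⟨p, hp⟩ ≠ u ⟨p, hp⟩ := by
    by_contra hno
    push Not at hno
    exact huw (Equiv.ext fun x => (hno x x.2).symm)
  classical
  obtain ⟨hpn, hpne⟩ := Nat.find_spec hex
  have hmin : ∀ x : Fin n, (x : ℕ) < Nat.find hex → w x = u x := by
    intro x hx
    have := Nat.find_min hex hx
    push Not at this
    exact this x.2
  obtain ⟨p, hp⟩ : ∃ p : Fin n, p = ⟨Nat.find hex, hpn⟩ := ⟨_, rfl⟩
  rw [← hp] at hpne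
  have hmin : ∀ x < p, w x = u x := fun x hx => hmin x (by rw [hp] at hx; exact hx)
  refine ⟨p, hmin, ?_⟩
  by_contra hlt
  have hlt : u p < w p := lt_of_le_of_ne (not_lt.1 hlt) (Ne.symm hpne)
  obtain ⟨y, hy⟩ : ∃ y, u p = w y := ⟨w.symm (u p), by simp⟩
  have hpy : p < y := by
    rcases lt_trichotomy p y with h1 | h1 | h1
    · exact h1
    · subst h1; exact absurd hy.symm hpne
    · have := hmin y h1
      rw [← hy] at this
      exact absurd (u.injective this) h1.ne'
  rw [hy] at hlt
  rcases lt_or_ge p c with h1 | h1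
  · have := G1 p h1
    rw [hy] at this
    simp only [Equiv.symm_apply_apply] at this
    exact S.s1 p y hpy this hlt hy
  rcases le_or_gt p b with h2 | h2
  · have := G2 p h2
    rw [hy] at this
    simp only [Equiv.symm_apply_apply] at this
    obtain ⟨k, k', h3, h4, h5, h6⟩ := descent w p y hpy hlt
    have := S.s4 k k' (h1.trans h3) (h4.trans_le this) h5 h6 p h3
    rw [hy] at this
    simp only [Equiv.symm_apply_apply] at this
    exact absurd h4 (not_lt.2 this)
  · exact S.s1' p y hpy h2 hlt hy

lemma gen_of_lollipop (hn : 2 ≤ n) (h : Fin n → Fin n) (H : Lollipop h) : GenInDegTwoQ h := by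
  obtain ⟨a, b, hab, hbn, k1, k2, k3⟩ := H
  have LPh : LP h (⟨a + 1, by omega⟩ : Fin n) (⟨b, by omega⟩ : Fin n) := by
    refine ⟨by simp [Fin.le_def]; omega, fun i j hij => ?_⟩
    have a1 := k1 i
    have a2 := k2 i
    have a3 := k3 i
    have := j.2
    simp only [Fin.lt_def, Fin.le_def] at *
    rcases Nat.lt_or_ge a i with c1 | c1
    · rcases Nat.lt_or_ge i b with c2 | c2
      · rw [a2 c1 c2]; omega
      · rw [a3 c2]; omega
    · rw [a1 c1]; omega
  intro f hf
  refine ⟨f, ?_, 0, fun i => gkm_const h 0, by simp⟩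
  exact tri (rho _ _) (GG h _ _) (GG_mem LPh) GG_self
    (fun w u hne => supp_rho LPh.le (GG_supp LPh w u hne))
    (fun w i j hij _ hw => rho_swap _ _ w i j hij hw) f hf

end Lolli

/-- let `n ≥ 2` and `h` a Hessenberg function on `[n]` with `h(j) ≥ j+1`
for all `j ∈ [n−1]`.  Then the `ℚ`-algebra `R(h)` is generated by the images of the
degree-2 elements of `H(h) ⊗ ℚ` if and only if `h` is of lollipop form. -/
theorem generated_in_degree_two_iff_lollipop (n : ℕ) (hn : 2 ≤ n)
    (h : Fin n → Fin n) (hmono : Monotone h) (hhess : ∀ j, j ≤ h j)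
    (hconn : ∀ j : Fin n, (j : ℕ) + 1 < n → (j : ℕ) + 1 ≤ (h j : ℕ)) :
    GenInDegTwoQ h ↔ Lollipop h := by
  exact ⟨Lolli.lollipop_of_gen hn h hmono hhess hconn, Lolli.gen_of_lollipop hn h⟩
end

section
/- Let h be a Hessenberg function on [n] of lollipop form. Then the GKM ring H(h) is generated, as a ring, by the constant functions (i.e., all elements of ℤ[t_1,…,t_n] regarded as constant maps S_n → ℤ[t_1,…,t_n]) together with the degree-2 elements of H(h). Equivalently, the equivariant cohomology H*_T(X(h)) is generated in degree 2 as an algebra over H*(BT). -/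
open MvPolynomial

/-- The GKM condition: `f` belongs to the GKM ring `H(h)` of the Hessenberg function `h`
(0-based indexing: position `j : Fin n` corresponds to `j+1 ∈ [n]`). -/
def InGKM {n : ℕ} (h : Fin n → Fin n)
    (f : Equiv.Perm (Fin n) → MvPolynomial (Fin n) ℤ) : Prop :=
  ∀ (w : Equiv.Perm (Fin n)) (i j : Fin n), j < i → i ≤ h j →
    f w - f (w * Equiv.swap i j) ∈ Ideal.span {X (w i) - X (w j)}

namespace LolliAux

open Equiv

abbrev Rg (n : ℕ) := MvPolynomial (Fin n) ℤ

/-- Adjacency of positions in the (double) lollipop graph. -/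
def Adj (p b i j : ℕ) : Prop :=
  i ≠ j ∧ ((i ≤ p ∧ j ≤ p) ∨ (b ≤ i ∧ b ≤ j) ∨
    (p ≤ i ∧ i ≤ b ∧ p ≤ j ∧ j ≤ b ∧ (i + 1 = j ∨ j + 1 = i)))

/-- The GKM condition in symmetric form. -/
def GKM {n : ℕ} (p b : ℕ) (f : Perm (Fin n) → Rg n) : Prop :=
  ∀ (w : Perm (Fin n)) (i j : Fin n), Adj p b i j →
    (X (w i) - X (w j) : Rg n) ∣ f w - f (w * swap i j)

/-- Substitution identifying the variables `k` and `l`. -/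
noncomputable def collapse {n : ℕ} (k l : Fin n) : Rg n →ₐ[ℤ] Rg n :=
  rename (fun x => if x = k then l else x)

lemma collapse_X {n : ℕ} (k l x : Fin n) :
    collapse k l (X x) = X (if x = k then l else x) := by
  simp [collapse]

lemma collapse_X_left {n : ℕ} (k l : Fin n) :
    collapse k l (X k) = collapse k l (X l) := by
  simp [collapse_X]

lemma dvd_sub_collapse {n : ℕ} (k l : Fin n) (p : Rg n) :
    (X k - X l : Rg n) ∣ p - collapse k l p := by
  induction p using MvPolynomial.induction_on with
  | C a => simp [collapse]
  | add p q hp hq =>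
    rw [map_add]
    have : p + q - (collapse k l p + collapse k l q) =
      (p - collapse k l p) + (q - collapse k l q) := by ring
    rw [this]; exact dvd_add hp hq
  | mul_X p x hp =>
    rw [map_mul]
    have : p * X x - collapse k l p * collapse k l (X x) =
      (p - collapse k l p) * X x + collapse k l p * (X x - collapse k l (X x)) := by ring
    rw [this]
    refine dvd_add (Dvd.dvd.mul_right hp _) (Dvd.dvd.mul_left ?_ _)
    rw [collapse_X]
    split_ifs with h
    · rw [h]
    · simp

lemma collapse_eq_iff {n : ℕ} (k l : Fin n) (p q : Rg n) :
    collapse k l p = collapse k l q ↔ (X k - X l : Rg n) ∣ p - q := by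
  constructor
  · intro h
    have : p - q = (p - collapse k l p) - (q - collapse k l q) := by rw [h]; ring
    rw [this]
    exact dvd_sub (dvd_sub_collapse k l p) (dvd_sub_collapse k l q)
  · rintro ⟨r, hr⟩
    have h2 := congrArg (collapse k l) hr
    rw [map_sub, map_mul, map_sub, collapse_X_left, sub_self, zero_mul] at h2
    exact sub_eq_zero.mp h2

lemma dvd_iff_collapse {n : ℕ} (k l : Fin n) (p : Rg n) :
    (X k - X l : Rg n) ∣ p ↔ collapse k l p = 0 := by
  have := collapse_eq_iff k l p 0
  rw [map_zero, sub_zero] at this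
  exact this.symm

lemma X_sub_ne {n : ℕ} {k l : Fin n} (h : k ≠ l) : (X k - X l : Rg n) ≠ 0 := by
  intro h2
  exact h (X_injective (sub_eq_zero.mp h2))

lemma prime_X_sub {n : ℕ} {k l : Fin n} (h : k ≠ l) : Prime (X k - X l : Rg n) := by
  refine ⟨X_sub_ne h, ?_, ?_⟩
  · intro hu
    have h1 := (dvd_iff_collapse k l 1).mp hu.dvd
    rw [map_one] at h1
    exact one_ne_zero h1
  · intro a c hac
    rw [dvd_iff_collapse, map_mul, mul_eq_zero] at hac
    rw [dvd_iff_collapse, dvd_iff_collapse]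
    exact hac

lemma relPrime_X_sub {n : ℕ} {k l m : Fin n} (hkl : k ≠ l) (hkm : k ≠ m) (hlm : l ≠ m) :
    IsRelPrime (X k - X l : Rg n) (X k - X m : Rg n) := by
  rw [(prime_X_sub hkl).irreducible.isRelPrime_iff_not_dvd]
  rw [dvd_iff_collapse, map_sub, collapse_X, collapse_X, if_pos rfl, if_neg hkm.symm]
  exact X_sub_ne hlm

/-- Newton interpolation. -/
lemma exists_interp {n : ℕ} {ι : Type*} [DecidableEq ι] (s : Finset ι) (t : ι → Fin n)
    (ht : Set.InjOn t s) (v : ι → Rg n)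
    (hv : ∀ i ∈ s, ∀ j ∈ s, i ≠ j → (X (t i) - X (t j) : Rg n) ∣ v i - v j) :
    ∃ P : Polynomial (Rg n), P.degree < s.card ∧ ∀ i ∈ s, P.eval (X (t i)) = v i := by
  induction s using Finset.induction_on with
  | empty => exact ⟨0, by simp⟩
  | insert a s ha ih =>
    obtain ⟨P, hP, hPe⟩ := ih (ht.mono (by simp))
      (fun i hi j hj => hv i (Finset.mem_insert_of_mem hi) j (Finset.mem_insert_of_mem hj))
    have hne : ∀ j ∈ s, a ≠ j := fun j hj h => ha (h ▸ hj)
    have htne : ∀ i ∈ insert a s, ∀ j ∈ insert a s, i ≠ j → t i ≠ t j := by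
      intro i hi j hj hij h
      exact hij (ht (by exact_mod_cast hi) (by exact_mod_cast hj) h)
    have hd : (∏ j ∈ s, (X (t a) - X (t j) : Rg n)) ∣ v a - P.eval (X (t a)) := by
      apply Finset.prod_dvd_of_isRelPrime
      · intro i hi j hj hij
        have hi' := Finset.mem_insert_of_mem (a := i) (b := a) hi
        have hj' := Finset.mem_insert_of_mem (a := j) (b := a) hj
        have haa := Finset.mem_insert_self a s
        exact relPrime_X_sub (htne _ haa _ hi' (hne i hi)) (htne _ haa _ hj' (hne j hj))
          (htne _ hi' _ hj' hij)
      · intro j hj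
        have h1 := hv a (Finset.mem_insert_self a s) j (Finset.mem_insert_of_mem hj) (hne j hj)
        have h2 := Polynomial.sub_dvd_eval_sub (X (t a)) (X (t j)) P
        rw [hPe j hj] at h2
        have : v a - P.eval (X (t a)) = (v a - v j) - (P.eval (X (t a)) - v j) := by ring
        rw [this]
        exact dvd_sub h1 h2
    obtain ⟨q, hq⟩ := hd
    refine ⟨P + Polynomial.C q * ∏ j ∈ s, (Polynomial.X - Polynomial.C (X (t j) : Rg n)), ?_, ?_⟩
    · rw [Finset.card_insert_of_notMem ha]
      have h3 : (Polynomial.C q * ∏ j ∈ s, (Polynomial.X - Polynomial.C (X (t j) : Rg n))).degree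
          ≤ (s.card : WithBot ℕ) := by
        refine (Polynomial.degree_mul_le _ _).trans ?_
        rw [Polynomial.degree_prod]
        simp only [Polynomial.degree_X_sub_C, Finset.sum_const, nsmul_eq_mul, mul_one]
        exact (add_le_add_left Polynomial.degree_C_le _).trans (by simp)
      refine lt_of_le_of_lt (Polynomial.degree_add_le _ _) (max_lt ?_ ?_)
      · exact hP.trans (by exact_mod_cast Nat.lt_succ_self _)
      · exact h3.trans_lt (by exact_mod_cast Nat.lt_succ_self _)
    · intro i hi
      rw [Polynomial.eval_add, Polynomial.eval_mul, Polynomial.eval_C, Polynomial.eval_prod]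
      simp only [Polynomial.eval_sub, Polynomial.eval_X, Polynomial.eval_C]
      rcases Finset.mem_insert.mp hi with rfl | hi
      · rw [mul_comm, ← hq]; ring
      · rw [Finset.prod_eq_zero hi (sub_self _), mul_zero, add_zero, hPe i hi]

/-- `f` is invariant under the permutations of the positions in `C`. -/
def Inv {n : ℕ} (C : Finset (Fin n)) (f : Perm (Fin n) → Rg n) : Prop :=
  ∀ (w π : Perm (Fin n)), (∀ i, i ∉ C → π i = i) → f (w * π) = f w

lemma swap_fix {n : ℕ} {C : Finset (Fin n)} {i j : Fin n} (hi : i ∈ C) (hj : j ∈ C) :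
    ∀ k, k ∉ C → swap i j k = k := by
  intro k hk
  exact swap_apply_of_ne_of_ne (fun h => hk (h ▸ hi)) (fun h => hk (h ▸ hj))

/-- Uniqueness of interpolation polynomials after collapsing. -/
lemma interp_unique {n : ℕ} (s : Finset (Fin n)) (φ : Rg n →ₐ[ℤ] Rg n) (x : Fin n → Rg n)
    (hx : Set.InjOn x s) (P Q : Polynomial (Rg n)) (hP : P.degree < s.card)
    (hQ : Q.degree < s.card) (v : Fin n → Rg n)
    (h1 : ∀ i ∈ s, (P.map φ.toRingHom).eval (x i) = v i)
    (h2 : ∀ i ∈ s, (Q.map φ.toRingHom).eval (x i) = v i) (d : ℕ) :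
    φ (P.coeff d) = φ (Q.coeff d) := by
  have := Polynomial.eq_of_degrees_lt_of_eval_index_eq (f := P.map φ.toRingHom)
    (g := Q.map φ.toRingHom) s hx (Polynomial.degree_map_le.trans_lt hP)
    (Polynomial.degree_map_le.trans_lt hQ) (fun i hi => by rw [h1 i hi, h2 i hi])
  have h3 := congrArg (fun R => Polynomial.coeff R d) this
  simpa using h3

lemma adj_comm {p b i j : ℕ} (h : Adj p b i j) : Adj p b j i := by
  unfold Adj at *; omega

lemma insertion_step {n : ℕ} (p b : ℕ) (C D : Finset (Fin n)) (m : Fin n) (hm : m ∉ C)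
    (hdisj : ∀ i ∈ insert m C, i ∉ D)
    (hadj : ∀ i ∈ insert m C, ∀ j ∈ insert m C, i ≠ j → Adj p b i j)
    (htwin : ∀ k ∈ insert m C, ∀ i j : Fin n, Adj p b i j → Adj p b (swap k m i) (swap k m j))
    (f : Perm (Fin n) → Rg n) (hf : GKM p b f) (hC : Inv C f) (hD : Inv D f) :
    ∃ (N : ℕ) (c : ℕ → Perm (Fin n) → Rg n),
      (∀ d, GKM p b (c d) ∧ Inv (insert m C) (c d) ∧ Inv D (c d)) ∧
      f = ∑ d ∈ Finset.range N, (fun w => (X (w m) : Rg n)) ^ d * c d := by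
  classical
  set C' := insert m C with hC'
  have hmC' : m ∈ C' := Finset.mem_insert_self _ _
  have hex : ∀ w : Perm (Fin n), ∃ P : Polynomial (Rg n), P.degree < C'.card ∧
      ∀ i ∈ C', P.eval (X (w i)) = f (w * swap i m) := by
    intro w
    apply exists_interp C' (fun i => w i) (fun i _ j _ h => w.injective h)
      (fun i => f (w * swap i m))
    intro i hi j hj hij
    by_cases him : i = m
    · subst him
      have h1 := hf w j i (hadj j hj i hi hij.symm)
      rw [swap_self]
      have h2 : f (w * (Equiv.refl (Fin n))) = f w := rfl
      rw [h2]
      rw [← neg_sub]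
      exact (neg_dvd).mpr h1
    by_cases hjm : j = m
    · subst hjm
      have h1 := hf w i j (hadj i hi j hj hij)
      rw [swap_self]
      have h2 : f (w * (Equiv.refl (Fin n))) = f w := rfl
      rw [h2, ← neg_sub (f w)]
      exact (dvd_neg).mpr h1
    have h1 := hf (w * swap i m) m j (hadj m hmC' j hj (Ne.symm hjm))
    have h2 : f (w * swap i m * swap m j) = f (w * swap j m) := by
      have h3 : w * swap i m * swap m j = w * swap j m * swap i j := by
        rw [mul_assoc, mul_assoc]
        congr 1
        ext k
        simp only [Perm.mul_apply, swap_apply_def]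
        split_ifs <;> simp_all
      rw [h3]
      refine hC _ _ (swap_fix ?_ ?_)
      · exact (Finset.mem_insert.mp hi).resolve_left him
      · exact (Finset.mem_insert.mp hj).resolve_left hjm
    rw [h2] at h1
    have h4 : (w * swap i m) m = w i := by simp
    have h5 : (w * swap i m) j = w j := by
      rw [Perm.mul_apply, swap_apply_of_ne_of_ne (Ne.symm hij) hjm]
    rw [h4, h5] at h1
    exact h1
  choose P hPd hPe using hex
  have hid : ∀ (q : Polynomial (Rg n)), q.map (AlgHom.id ℤ (Rg n)).toRingHom = q := by
    intro q; exact Polynomial.map_id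
  refine ⟨C'.card, fun d w => (P w).coeff d, ?_, ?_⟩
  · intro d
    have hinv : Inv C' (fun w => (P w).coeff d) := by
      intro w σ hσ
      have hσC : ∀ i ∈ C', σ i ∈ C' := by
        intro i hi
        by_contra h
        have := hσ _ h
        have h2 := σ.injective this
        rw [h2] at h; exact h hi
      refine interp_unique C' (AlgHom.id ℤ _) (fun i => X (w (σ i)))
        (fun i _ j _ h => σ.injective (w.injective (X_injective h)))
        (P (w * σ)) (P w) (hPd _) (hPd _) (fun i => f (w * swap (σ i) m)) ?_ ?_ d
      · intro i hi
        rw [hid]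
        have h1 := hPe (w * σ) i hi
        rw [Perm.mul_apply] at h1
        rw [h1]
        have h2 : w * σ * swap i m = w * swap (σ i) m * (swap (σ i) m * σ * swap i m) := by
          simp [mul_assoc]
        rw [h2]
        apply hC
        intro k hk
        by_cases hkm : k = m
        · subst hkm; simp [Perm.mul_apply]
        · have hk' : k ∉ C' := by
            rw [hC', Finset.mem_insert]; tauto
          have hki : k ≠ i := fun h => hk' (h ▸ hi)
          have hki' : k ≠ σ i := fun h => hk' (h ▸ hσC i hi)
          rw [Perm.mul_apply, Perm.mul_apply, swap_apply_of_ne_of_ne hki hkm, hσ k hk',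
            swap_apply_of_ne_of_ne hki' hkm]
      · intro i hi
        rw [hid]
        exact hPe w (σ i) (hσC i hi)
    refine ⟨?_, hinv, ?_⟩
    · intro w i j hij
      by_cases hboth : i ∈ C' ∧ j ∈ C'
      · have := hinv w (swap i j) (swap_fix hboth.1 hboth.2)
        beta_reduce at this ⊢
        rw [this, sub_self]
        exact dvd_zero _
      · rw [← collapse_eq_iff]
        set φ := collapse (w i) (w j) with hφ
        have hXX : ∀ k, φ (X (w (swap i j k))) = φ (X (w k)) := by
          intro k
          by_cases h1 : k = i
          · subst h1; rw [swap_apply_left]; exact (collapse_X_left _ _).symm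
          by_cases h2 : k = j
          · subst h2; rw [swap_apply_right]; exact (collapse_X_left _ _)
          rw [swap_apply_of_ne_of_ne h1 h2]
        refine interp_unique C' φ (fun k => φ (X (w k))) ?_ (P w) (P (w * swap i j)) (hPd _)
          (hPd _) (fun k => φ (f (w * swap k m))) ?_ ?_ d
        · intro k hk l hl hkl
          simp only [hφ, collapse_X] at hkl
          have h3 := X_injective hkl
          simp only [EmbeddingLike.apply_eq_iff_eq] at h3
          split_ifs at h3 with h4 h5 h5
          · rw [h4, h5]
          · exfalso; have h6 := w.injective h3
            exact hboth ⟨h4 ▸ hk, h6 ▸ hl⟩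
          · exfalso; have h6 := w.injective h3
            exact hboth ⟨h5 ▸ hl, h6 ▸ hk⟩
          · exact w.injective h3
        · intro k hk
          have := congrArg φ (hPe w k hk)
          rw [← this]
          exact Polynomial.eval_map_apply (f := φ.toRingHom) (X (w k))
        · intro k hk
          have := congrArg φ (hPe (w * swap i j) k hk)
          have h7 : φ (f (w * swap k m)) = φ (f (w * swap i j * swap k m)) := by
            rw [hφ, collapse_eq_iff]
            have h8 := hf (w * swap k m) _ _ (htwin k hk i j hij)
            simp only [Perm.mul_apply, swap_apply_self] at h8
            have h9 : w * swap k m * swap (swap k m i) (swap k m j) = w * swap i j * swap k m := by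
              rw [mul_assoc, mul_assoc]
              congr 1
              rw [Equiv.mul_swap_eq_swap_mul, swap_apply_self, swap_apply_self]
            rw [h9] at h8
            exact h8
          rw [h7, ← this]
          rw [← hXX k]
          exact Polynomial.eval_map_apply (f := φ.toRingHom) (X (w (swap i j k)))
    · intro w σ hσ
      have hσC : ∀ i ∈ C', σ i = i := fun i hi => hσ i (hdisj i hi)
      refine interp_unique C' (AlgHom.id ℤ _) (fun i => X (w i))
        (fun i _ j _ h => (w.injective (X_injective h)))
        (P (w * σ)) (P w) (hPd _) (hPd _) (fun i => f (w * swap i m)) ?_ ?_ d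
      · intro i hi
        rw [hid]
        have h1 := hPe (w * σ) i hi
        rw [Perm.mul_apply, hσC i hi] at h1
        rw [h1]
        have h2 : w * σ * swap i m = w * swap i m * σ := by
          rw [mul_assoc, mul_assoc, Equiv.mul_swap_eq_swap_mul, hσC i hi, hσC m hmC']
        rw [h2]
        exact hD _ _ hσ
      · intro i hi
        rw [hid]
        exact hPe w i hi
  · funext w
    rw [Finset.sum_apply]
    simp only [Pi.mul_apply, Pi.pow_apply]
    have h1 := hPe w m hmC'
    rw [swap_self] at h1
    have h2 : f (w * (Equiv.refl (Fin n))) = f w := rfl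
    rw [← h2, ← h1]
    rw [Polynomial.eval_eq_sum_range' (n := C'.card)]
    · exact Finset.sum_congr rfl (fun d _ => mul_comm _ _)
    · by_cases h0 : P w = 0
      · rw [h0]; simpa using ⟨m, hmC'⟩
      · exact (Polynomial.natDegree_lt_iff_degree_lt h0).mpr (hPd w)

lemma inv_app {n : ℕ} (u : Perm (Fin n)) (i : Fin n) : u⁻¹ (u i) = i := by simp

lemma app_inv {n : ℕ} (u : Perm (Fin n)) (i : Fin n) : u (u⁻¹ i) = i := by simp

lemma collapse_swap {n : ℕ} (w : Perm (Fin n)) (i j k : Fin n) :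
    collapse (w i) (w j) (X (w (swap i j k))) = collapse (w i) (w j) (X (w k)) := by
  by_cases h1 : k = i
  · subst h1; rw [swap_apply_left]; exact (collapse_X_left _ _).symm
  by_cases h2 : k = j
  · subst h2; rw [swap_apply_right]; exact (collapse_X_left _ _)
  rw [swap_apply_of_ne_of_ne h1 h2]

lemma collapse_mem {n : ℕ} (w : Perm (Fin n)) (i j k l : Fin n) (hk : k = i ∨ k = j)
    (hl : l = i ∨ l = j) :
    collapse (w i) (w j) (X (w k)) = collapse (w i) (w j) (X (w l)) := by
  have := collapse_X_left (w i) (w j)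
  rcases hk with rfl | rfl <;> rcases hl with rfl | rfl <;> simp [this]

/-- Labels of the degree two generators. -/
inductive Ky (n : ℕ) : Type
  | base : Ky n
  | L (m : Fin n) : Ky n
  | R (m : Fin n) : Ky n
  | C (s : ℕ) (S : Finset (Fin n)) : Ky n

/-- The set of values at positions `< s`. -/
def flag {n : ℕ} (u : Perm (Fin n)) (s : ℕ) : Finset (Fin n) :=
  Finset.univ.filter (fun k => ((u⁻¹ k : Fin n) : ℕ) < s)

lemma mem_flag {n : ℕ} (u : Perm (Fin n)) (s : ℕ) (k : Fin n) :
    k ∈ flag u s ↔ ((u⁻¹ k : Fin n) : ℕ) < s := by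
  simp [flag]

/-- The permutation `u` lies on the facet with the given label. -/
def On {n : ℕ} (p b : ℕ) (u : Perm (Fin n)) : Ky n → Prop
  | Ky.base => True
  | Ky.L m => ((u⁻¹ m : Fin n) : ℕ) < p
  | Ky.R m => b < ((u⁻¹ m : Fin n) : ℕ)
  | Ky.C s S => p < s ∧ s ≤ b ∧ S = flag u s

def pos {n : ℕ} (hn : 0 < n) (k : ℕ) : Fin n := ⟨k % n, Nat.mod_lt _ hn⟩

lemma pos_val {n : ℕ} (hn : 0 < n) (k : Fin n) : pos hn k = k := by
  ext; simp [pos, Nat.mod_eq_of_lt k.2]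

lemma pos_eq {n : ℕ} (hn : 0 < n) (k : Fin n) (l : ℕ) (h : (k : ℕ) = l) : pos hn l = k := by
  subst h; exact pos_val hn k

noncomputable def val {n : ℕ} (hn : 0 < n) (p b : ℕ) (u : Perm (Fin n)) : Ky n → Rg n
  | Ky.base => X (u (pos hn p))
  | Ky.L m => X m - X (u (pos hn p))
  | Ky.R m => X m - X (u (pos hn b))
  | Ky.C s _ => X (u (pos hn (s - 1))) - X (u (pos hn s))

open Classical in
noncomputable def gen {n : ℕ} (hn : 0 < n) (p b : ℕ) (κ : Ky n) (u : Perm (Fin n)) : Rg n :=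
  if On p b u κ then val hn p b u κ else 0

lemma val_swap {n : ℕ} (hn : 0 < n) (p b : ℕ) (w : Perm (Fin n)) (i j : Fin n) (κ : Ky n) :
    collapse (w i) (w j) (val hn p b (w * swap i j) κ) =
      collapse (w i) (w j) (val hn p b w κ) := by
  cases κ <;> simp only [val, Perm.mul_apply, map_sub, collapse_swap]

lemma val_zero {n : ℕ} (hn : 0 < n) (p b : ℕ) (hpb : p ≤ b) (w : Perm (Fin n)) (i j : Fin n)
    (hij : Adj p b i j) (κ : Ky n) (h : ¬ (On p b w κ ↔ On p b (w * swap i j) κ)) :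
    collapse (w i) (w j) (val hn p b w κ) = 0 := by
  have hinv : ∀ k, (w * swap i j)⁻¹ k = swap i j (w⁻¹ k) := by
    intro k; simp [mul_inv_rev, Perm.mul_apply]
  cases κ with
  | base => simp [On] at h
  | L m =>
    simp only [On, hinv] at h
    obtain ⟨q, rfl⟩ := w.surjective m
    simp only [inv_app] at h
    simp only [val, map_sub]
    rw [sub_eq_zero]
    unfold Adj at hij
    by_cases h1 : q = i
    · subst h1
      rw [swap_apply_left] at h
      apply collapse_mem
      · simp
      · by_cases h2 : (q : ℕ) = p
        · left; exact pos_eq hn q p h2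
        · right; exact pos_eq hn j p (by omega)
    · by_cases h2 : q = j
      · subst h2
        rw [swap_apply_right] at h
        apply collapse_mem
        · simp
        · by_cases h2 : (q : ℕ) = p
          · right; exact pos_eq hn q p h2
          · left; exact pos_eq hn i p (by omega)
      · rw [swap_apply_of_ne_of_ne h1 h2] at h
        exact absurd Iff.rfl h
  | R m =>
    simp only [On, hinv] at h
    obtain ⟨q, rfl⟩ := w.surjective m
    simp only [inv_app] at h
    simp only [val, map_sub]
    rw [sub_eq_zero]
    unfold Adj at hij
    by_cases h1 : q = i
    · subst h1
      rw [swap_apply_left] at h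
      apply collapse_mem
      · simp
      · by_cases h2 : (q : ℕ) = b
        · left; exact pos_eq hn q b h2
        · right; exact pos_eq hn j b (by omega)
    · by_cases h2 : q = j
      · subst h2
        rw [swap_apply_right] at h
        apply collapse_mem
        · simp
        · by_cases h2 : (q : ℕ) = b
          · right; exact pos_eq hn q b h2
          · left; exact pos_eq hn i b (by omega)
      · rw [swap_apply_of_ne_of_ne h1 h2] at h
        exact absurd Iff.rfl h
  | C s S =>
    simp only [On] at h
    have hs : p < s ∧ s ≤ b := by
      by_contra hc; apply h; tauto
    have hfl : flag w s ≠ flag (w * swap i j) s := by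
      intro hc; apply h; rw [hc]
    have hne : ¬ ((i : ℕ) < s ↔ (j : ℕ) < s) := by
      intro hc
      apply hfl
      ext k
      rw [mem_flag, mem_flag, hinv]
      by_cases h1 : w⁻¹ k = i
      · rw [h1, swap_apply_left]; exact hc
      by_cases h2 : w⁻¹ k = j
      · rw [h2, swap_apply_right]; exact hc.symm
      rw [swap_apply_of_ne_of_ne h1 h2]
    simp only [val, map_sub]
    rw [sub_eq_zero]
    unfold Adj at hij
    apply collapse_mem
    · by_cases h2 : (i : ℕ) = s - 1
      · left; exact pos_eq hn i _ h2
      · right; exact pos_eq hn j _ (by omega)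
    · by_cases h2 : (i : ℕ) = s
      · left; exact pos_eq hn i _ h2
      · right; exact pos_eq hn j _ (by omega)

lemma gen_GKM {n : ℕ} (hn : 0 < n) (p b : ℕ) (hpb : p ≤ b) (κ : Ky n) :
    GKM p b (gen hn p b κ) := by
  intro w i j hij
  rw [← collapse_eq_iff]
  by_cases h : (On p b w κ ↔ On p b (w * swap i j) κ)
  · unfold gen
    by_cases h1 : On p b w κ
    · rw [if_pos h1, if_pos (h.mp h1), val_swap]
    · rw [if_neg h1, if_neg (fun hc => h1 (h.mpr hc))]
  · have h0 := val_zero hn p b hpb w i j hij κ h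
    have h1 := val_swap hn p b w i j κ
    unfold gen
    split_ifs <;> simp [h0, h1]

lemma gen_homog {n : ℕ} (hn : 0 < n) (p b : ℕ) (κ : Ky n) (u : Perm (Fin n)) :
    (gen hn p b κ u).IsHomogeneous 1 := by
  unfold gen
  split_ifs
  · cases κ <;> simp only [val]
    · exact isHomogeneous_X _ _
    all_goals exact (isHomogeneous_X _ _).sub (isHomogeneous_X _ _)
  · exact isHomogeneous_zero _ _ _

/-- Writing polynomials in terms of the local coordinates at `u`. -/
noncomputable def Psi {n : ℕ} (p b : ℕ) (u : Perm (Fin n)) :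
    Rg n →ₐ[ℤ] MvPolynomial (Ky n) ℤ :=
  aeval (fun m => X Ky.base + (if ((u⁻¹ m : Fin n) : ℕ) < p then X (Ky.L m) else 0)
    - (∑ s ∈ Finset.Ioc p b,
        if s ≤ ((u⁻¹ m : Fin n) : ℕ) then X (Ky.C s (flag u s)) else 0)
    + (if b < ((u⁻¹ m : Fin n) : ℕ) then X (Ky.R m) else 0))

noncomputable def ev {n : ℕ} (hn : 0 < n) (p b : ℕ) (u : Perm (Fin n)) :
    MvPolynomial (Ky n) ℤ →ₐ[ℤ] Rg n :=
  aeval (fun κ => gen hn p b κ u)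

lemma telescope {A : Type*} [CommRing A] (a : ℕ → A) (p b q : ℕ) (hpb : p ≤ b) :
    (∑ s ∈ Finset.Ioc p b, if s ≤ q then a (s - 1) - a s else 0) =
      a p - a (max p (min q b)) := by
  induction b, hpb using Nat.le_induction with
  | base => simp
  | succ b hb ih =>
    rw [Finset.sum_Ioc_succ_top (by omega), ih]
    split_ifs with h
    · have h1 : max p (min q b) = b := by omega
      have h2 : max p (min q (b + 1)) = b + 1 := by omega
      rw [h1, h2]; simp
    · have h1 : max p (min q b) = max p (min q (b + 1)) := by omega
      rw [h1]; simp

lemma ev_Psi {n : ℕ} (hn : 0 < n) (p b : ℕ) (hpb : p ≤ b) (u : Perm (Fin n)) (q : Rg n) :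
    ev hn p b u (Psi p b u q) = q := by
  have : (ev hn p b u).comp (Psi p b u) = AlgHom.id ℤ (Rg n) := by
    apply MvPolynomial.algHom_ext
    intro m
    obtain ⟨q, rfl⟩ := u.surjective m
    simp only [AlgHom.comp_apply, Psi, aeval_X, AlgHom.id_apply, map_add, map_sub, map_sum,
      inv_app]
    have h1 : ∀ s ∈ Finset.Ioc p b, ev hn p b u (if s ≤ (q : ℕ) then X (Ky.C s (flag u s)) else 0) =
        if s ≤ (q : ℕ) then X (u (pos hn (s - 1))) - X (u (pos hn s)) else 0 := by
      intro s hs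
      rw [Finset.mem_Ioc] at hs
      split_ifs with h
      · simp [ev, gen, On, val, hs]
      · simp
    rw [Finset.sum_congr rfl h1, telescope (fun s => (X (u (pos hn s)) : Rg n)) p b q hpb]
    have h2 : ev hn p b u (X Ky.base) = X (u (pos hn p)) := by simp [ev, gen, On, val]
    have h3 : ev hn p b u (if (q : ℕ) < p then X (Ky.L (u q)) else 0) =
        if (q : ℕ) < p then X (u q) - X (u (pos hn p)) else 0 := by
      split_ifs with h
      · simp [ev, gen, On, val, h]
      · simp
    have h4 : ev hn p b u (if b < (q : ℕ) then X (Ky.R (u q)) else 0) =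
        if b < (q : ℕ) then X (u q) - X (u (pos hn b)) else 0 := by
      split_ifs with h
      · simp [ev, gen, On, val, h]
      · simp
    rw [h2, h3, h4]
    by_cases c1 : (q : ℕ) < p
    · have : max p (min (q : ℕ) b) = p := by omega
      rw [if_pos c1, if_neg (by omega), this]; ring
    · by_cases c2 : b < (q : ℕ)
      · have : max p (min (q : ℕ) b) = b := by omega
        rw [if_neg c1, if_pos c2, this]; ring
      · have : max p (min (q : ℕ) b) = q := by omega
        rw [if_neg c1, if_neg c2, this, pos_val]; ring
  exact congrArg (fun φ => φ q) this

open Classical in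
noncomputable def kill {n : ℕ} (K : Finset (Ky n)) :
    MvPolynomial (Ky n) ℤ →ₐ[ℤ] MvPolynomial (Ky n) ℤ :=
  aeval (fun κ => if κ ∈ K then X κ else 0)

open Classical in
lemma coeff_kill {n : ℕ} (α : Ky n →₀ ℕ) (q : MvPolynomial (Ky n) ℤ) :
    coeff α (kill α.support q) = coeff α q := by
  induction q using MvPolynomial.induction_on' with
  | monomial β c =>
    by_cases h : β.support ⊆ α.support
    · congr 1
      rw [kill, aeval_monomial, monomial_eq]
      congr 1
      apply Finsupp.prod_congr
      intro κ hκ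
      rw [if_pos (h hκ)]
    · obtain ⟨κ, h1, h2⟩ := Finset.not_subset.mp h
      have hne : β ≠ α := fun hc => h2 (hc ▸ h1)
      rw [coeff_monomial, if_neg hne, kill, aeval_monomial]
      rw [Finsupp.prod, Finset.prod_eq_zero h1, mul_zero, coeff_zero]
      rw [if_neg h2]
      exact zero_pow (Finsupp.mem_support_iff.mp h1)
  | add p q hp hq => rw [map_add, coeff_add, coeff_add, hp, hq]

def Face {n : ℕ} (p b : ℕ) (K : Finset (Ky n)) (u : Perm (Fin n)) : Prop :=
  ∀ κ ∈ K, On p b u κ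

noncomputable def theta {n : ℕ} (p b : ℕ) (K : Finset (Ky n)) (u : Perm (Fin n)) :
    Rg n →ₐ[ℤ] MvPolynomial (Ky n) ℤ := (kill K).comp (Psi p b u)

open Classical in
lemma theta_X {n : ℕ} (p b : ℕ) (K : Finset (Ky n)) (u : Perm (Fin n)) (hu : Face p b K u)
    (m : Fin n) :
    theta p b K u (X m) = (if Ky.base ∈ K then X Ky.base else 0)
      + (if Ky.L m ∈ K then X (Ky.L m) else 0)
      - (∑ s ∈ Finset.Ioc p b, if Ky.C s (flag u s) ∈ K ∧ s ≤ ((u⁻¹ m : Fin n) : ℕ)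
          then X (Ky.C s (flag u s)) else 0)
      + (if Ky.R m ∈ K then X (Ky.R m) else 0) := by
  simp only [theta, AlgHom.comp_apply, Psi, aeval_X, map_add, map_sub, map_sum]
  congr 1
  · congr 1
    · congr 1
      · simp [kill]
      · by_cases h : Ky.L m ∈ K
        · have := hu _ h
          simp only [On] at this
          rw [if_pos this]; simp [kill]
        · split_ifs <;> simp [kill, h]
    · apply Finset.sum_congr rfl
      intro s hs
      by_cases h1 : s ≤ ((u⁻¹ m : Fin n) : ℕ)
      · rw [if_pos h1]; simp only [h1, and_true]; simp [kill]
      · rw [if_neg h1]; simp only [h1, and_false, if_false, map_zero]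
  · by_cases h : Ky.R m ∈ K
    · have := hu _ h
      simp only [On] at this
      rw [if_pos this]; simp [kill]
    · split_ifs <;> simp [kill, h]

lemma face_flag {n : ℕ} {p b : ℕ} {K : Finset (Ky n)} {u : Perm (Fin n)} (hu : Face p b K u)
    {s : ℕ} {S : Finset (Fin n)} (h : Ky.C s S ∈ K) : S = flag u s := (hu _ h).2.2

lemma theta_eq {n : ℕ} (p b : ℕ) (K : Finset (Ky n)) (u v : Perm (Fin n)) (hu : Face p b K u)
    (hv : Face p b K v) : theta p b K u = theta p b K v := by
  classical
  apply MvPolynomial.algHom_ext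
  intro m
  rw [theta_X p b K u hu, theta_X p b K v hv]
  congr 2
  apply Finset.sum_congr rfl
  intro s _
  by_cases h : flag u s = flag v s
  · have h2 : s ≤ ((u⁻¹ m : Fin n) : ℕ) ↔ s ≤ ((v⁻¹ m : Fin n) : ℕ) := by
      rw [← not_lt, ← not_lt, ← mem_flag, ← mem_flag, h]
    simp only [h, h2]
  · have h1 : Ky.C s (flag u s) ∉ K := fun hc => h (face_flag hv hc)
    have h2 : Ky.C s (flag v s) ∉ K := fun hc => h (face_flag hu hc).symm
    simp [h1, h2]

def Free {n : ℕ} (K : Finset (Ky n)) (m : Fin n) : Prop := Ky.L m ∉ K ∧ Ky.R m ∉ K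

def Blk {n : ℕ} (K : Finset (Ky n)) (i j : ℕ) : Prop :=
  ∀ s S, Ky.C s S ∈ K → (i < s ↔ j < s)

lemma flag_swap {n : ℕ} (u : Perm (Fin n)) (i j : Fin n) (s : ℕ)
    (h : (i : ℕ) < s ↔ (j : ℕ) < s) : flag (u * swap i j) s = flag u s := by
  ext k
  rw [mem_flag, mem_flag]
  have hinv : (u * swap i j)⁻¹ k = swap i j (u⁻¹ k) := by
    simp [mul_inv_rev, Perm.mul_apply]
  rw [hinv]
  by_cases h1 : u⁻¹ k = i
  · rw [h1, swap_apply_left]; exact h.symm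
  by_cases h2 : u⁻¹ k = j
  · rw [h2, swap_apply_right]; exact h
  rw [swap_apply_of_ne_of_ne h1 h2]

lemma face_swap {n : ℕ} {p b : ℕ} {K : Finset (Ky n)} {u : Perm (Fin n)} (hu : Face p b K u)
    {i j : Fin n} (hi : Free K (u i)) (hj : Free K (u j)) (hb : Blk K i j) :
    Face p b K (u * swap i j) := by
  have hinv : ∀ m, ¬ Free K m → (u * swap i j)⁻¹ m = u⁻¹ m := by
    intro m hm
    have h0 : (u * swap i j)⁻¹ m = swap i j (u⁻¹ m) := by
      simp [mul_inv_rev, Perm.mul_apply]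
    rw [h0, swap_apply_of_ne_of_ne]
    · rintro rfl; exact hm (by simpa using hi)
    · rintro rfl; exact hm (by simpa using hj)
  intro κ hκ
  have h1 := hu κ hκ
  cases κ with
  | base => trivial
  | L m =>
    simp only [On] at *
    rw [hinv m (fun h => h.1 hκ)]; exact h1
  | R m =>
    simp only [On] at *
    rw [hinv m (fun h => h.2 hκ)]; exact h1
  | C s S =>
    simp only [On] at *
    rw [flag_swap u i j s (hb s S hκ)]; exact h1

/-- Swapping `i` and `j` does not change the reduced value of `f`. -/
def Good {n : ℕ} (p b : ℕ) (K : Finset (Ky n)) (f : Perm (Fin n) → Rg n) (i j : Fin n) : Prop :=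
  ∀ u, Face p b K u → Free K (u i) → Free K (u j) →
    theta p b K (u * swap i j) (f (u * swap i j)) = theta p b K u (f u)

lemma good_adj {n : ℕ} {p b : ℕ} {K : Finset (Ky n)} {f : Perm (Fin n) → Rg n}
    (hf : GKM p b f) {i j : Fin n} (hij : Adj p b i j) (hb : Blk K i j) : Good p b K f i j := by
  classical
  intro u hu hi hj
  have hu' := face_swap hu hi hj hb
  rw [theta_eq p b K _ u hu' hu]
  obtain ⟨r, hr⟩ := hf u i j hij
  have h1 : theta p b K u (X (u i)) = theta p b K u (X (u j)) := by
    rw [theta_X p b K u hu, theta_X p b K u hu, if_neg hi.1, if_neg hj.1, if_neg hi.2, if_neg hj.2]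
    congr 2
    apply Finset.sum_congr rfl
    intro s _
    simp only [inv_app]
    by_cases h : Ky.C s (flag u s) ∈ K
    · have h2 := hb s _ h
      have h3 : s ≤ (i : ℕ) ↔ s ≤ (j : ℕ) := by omega
      simp only [h3]
    · simp [h]
  have h2 := congrArg (theta p b K u) hr
  rw [map_sub, map_mul, map_sub, h1, sub_self, zero_mul] at h2
  exact (sub_eq_zero.mp h2).symm

lemma good_symm {n : ℕ} {p b : ℕ} {K : Finset (Ky n)} {f : Perm (Fin n) → Rg n} {i j : Fin n}
    (h : Good p b K f i j) : Good p b K f j i := by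
  intro u hu hi hj
  rw [swap_comm]
  exact h u hu hj hi

lemma good_trans {n : ℕ} {p b : ℕ} {K : Finset (Ky n)} {f : Perm (Fin n) → Rg n} {i j k : Fin n}
    (hik : i ≠ k) (hij' : i ≠ j) (hjk' : j ≠ k)
    (hpj : p ≤ (j : ℕ)) (hjb : (j : ℕ) ≤ b) (hij : Good p b K f i j) (hjk : Good p b K f j k)
    (b1 : Blk K i j) (b2 : Blk K j k) : Good p b K f i k := by
  intro u hu hi hk
  have hj : Free K (u j) := by
    constructor
    · intro h; have := hu _ h; simp only [On, inv_app] at this; omega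
    · intro h; have := hu _ h; simp only [On, inv_app] at this; omega
  have e1 : (u * swap i j) j = u i := by simp
  have e2 : (u * swap i j) k = u k := by
    rw [Perm.mul_apply, swap_apply_of_ne_of_ne hik.symm hjk'.symm]
  have e3 : (u * swap i j) i = u j := by simp
  have e4 : (u * swap i j * swap j k) i = u j := by
    rw [Perm.mul_apply, swap_apply_of_ne_of_ne hij' hik, e3]
  have e5 : (u * swap i j * swap j k) j = u k := by
    rw [Perm.mul_apply, swap_apply_left, e2]
  have h1 := hij u hu hi hj
  have f1 := face_swap hu hi hj b1
  have h2 := hjk (u * swap i j) f1 (by rw [e1]; exact hi) (by rw [e2]; exact hk)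
  have f2 := face_swap f1 (i := j) (j := k) (by rw [e1]; exact hi) (by rw [e2]; exact hk) b2
  have h3 := hij (u * swap i j * swap j k) f2 (by rw [e4]; exact hj) (by rw [e5]; exact hk)
  have e6 : u * swap i j * swap j k * swap i j = u * swap i k := by
    rw [mul_assoc, mul_assoc]
    congr 1
    ext l
    simp only [Perm.mul_apply, swap_apply_def]
    split_ifs <;> simp_all
  rw [e6] at h3
  rw [h3, h2, h1]

lemma good_mid {n : ℕ} {p b : ℕ} {K : Finset (Ky n)} {f : Perm (Fin n) → Rg n}
    (hf : GKM p b f) (d : ℕ) : ∀ i j : Fin n, (j : ℕ) = i + d + 1 → p ≤ (i : ℕ) → (j : ℕ) ≤ b →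
      Blk K i j → Good p b K f i j := by
  induction d with
  | zero =>
    intro i j hij hi hj hb
    exact good_adj hf (by unfold Adj; omega) hb
  | succ d ih =>
    intro i j hij hi hj hb
    have hk : (i : ℕ) + d + 1 < n := by have := j.2; omega
    have b1 : Blk K i ((i : ℕ) + d + 1) := by
      intro s S h; have := hb s S h; omega
    have b2 : Blk K ((i : ℕ) + d + 1) j := by
      intro s S h; have := hb s S h; omega
    refine good_trans (j := ⟨i + d + 1, hk⟩) ?_ ?_ ?_ (by simp; omega) (by simp; omega)
      (ih i ⟨i + d + 1, hk⟩ rfl hi (by simp; omega) b1)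
      (good_adj hf (by unfold Adj; simp; omega) b2) b1 b2
    · intro h; have := congrArg Fin.val h; omega
    · intro h; have := congrArg Fin.val h; simp at this; omega
    · intro h; have := congrArg Fin.val h; simp at this; omega

lemma good_right {n : ℕ} {p b : ℕ} (hpb : p ≤ b) {K : Finset (Ky n)}
    {f : Perm (Fin n) → Rg n} (hf : GKM p b f) (i j : Fin n) (hij : i < j) (hi : p ≤ (i : ℕ))
    (hb : Blk K i j) : Good p b K f i j := by
  have hij' : (i : ℕ) < j := hij
  by_cases h1 : (j : ℕ) ≤ b
  · exact good_mid hf (j - i - 1) i j (by omega) hi h1 hb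
  by_cases h2 : b ≤ (i : ℕ)
  · exact good_adj hf (by unfold Adj; omega) hb
  have hk : b < n := by have := j.2; omega
  have b1 : Blk K i b := by
    intro s S h; have := hb s S h; omega
  have b2 : Blk K b j := by
    intro s S h; have := hb s S h; omega
  refine good_trans (j := ⟨b, hk⟩) ?_ ?_ ?_ hpb le_rfl
    (good_mid hf (b - i - 1) i ⟨b, hk⟩ (by simp; omega) hi le_rfl b1)
    (good_adj hf (by unfold Adj; simp; omega) b2) b1 b2
  · intro h; have := congrArg Fin.val h; omega
  · intro h; have := congrArg Fin.val h; simp at this; omega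
  · intro h; have := congrArg Fin.val h; simp at this; omega

lemma good_lt {n : ℕ} {p b : ℕ} (hpb : p ≤ b) {K : Finset (Ky n)}
    {f : Perm (Fin n) → Rg n} (hf : GKM p b f) (i j : Fin n) (hij : i < j)
    (hb : Blk K i j) : Good p b K f i j := by
  have hij' : (i : ℕ) < j := hij
  by_cases h1 : p ≤ (i : ℕ)
  · exact good_right hpb hf i j hij h1 hb
  by_cases h2 : (j : ℕ) ≤ p
  · exact good_adj hf (by unfold Adj; omega) hb
  have hk : p < n := by have := j.2; omega
  have b1 : Blk K i p := by
    intro s S h; have := hb s S h; omega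
  have b2 : Blk K p j := by
    intro s S h; have := hb s S h; omega
  refine good_trans (j := ⟨p, hk⟩) ?_ ?_ ?_ le_rfl hpb
    (good_adj hf (by unfold Adj; simp; omega) b1)
    (good_right hpb hf ⟨p, hk⟩ j (by rw [Fin.lt_def]; simp; omega) le_rfl b2) b1 b2
  · intro h; have := congrArg Fin.val h; omega
  · intro h; have := congrArg Fin.val h; simp at this; omega
  · intro h; have := congrArg Fin.val h; simp at this; omega

lemma good_all {n : ℕ} {p b : ℕ} (hpb : p ≤ b) {K : Finset (Ky n)}
    {f : Perm (Fin n) → Rg n} (hf : GKM p b f) (i j : Fin n) (hij : i ≠ j)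
    (hb : Blk K i j) : Good p b K f i j := by
  rcases lt_or_gt_of_ne hij with h | h
  · exact good_lt hpb hf i j h hb
  · exact good_symm (good_lt hpb hf j i h (fun s S hS => (hb s S hS).symm))

/-- Positions `< p`, and positions `> b`. -/
def Lft (n p : ℕ) : Finset (Fin n) := Finset.univ.filter (fun i => (i : ℕ) < p)
def Rgt (n b : ℕ) : Finset (Fin n) := Finset.univ.filter (fun i => b < (i : ℕ))

/-- A swap of two twin positions. -/
lemma twin_swap {n : ℕ} {p b : ℕ} (hpb : p ≤ b) {K : Finset (Ky n)}
    {f : Perm (Fin n) → Rg n} (hL : Inv (Lft n p) f) (hR : Inv (Rgt n b) f)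
    (u : Perm (Fin n)) (hu : Face p b K u) (i j : Fin n)
    (hij : ((i : ℕ) < p ∧ (j : ℕ) < p) ∨ (b < (i : ℕ) ∧ b < (j : ℕ))) :
    Face p b K (u * swap i j) ∧
    theta p b K (u * swap i j) (f (u * swap i j)) = theta p b K u (f u) := by
  have hF : Face p b K (u * swap i j) := by
    intro κ hκ
    have h1 := hu κ hκ
    have hinv : ∀ k, (u * swap i j)⁻¹ k = swap i j (u⁻¹ k) := by
      intro k; simp [mul_inv_rev, Perm.mul_apply]
    cases κ with
    | base => trivial
    | L m =>
      simp only [On, hinv] at *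
      rw [swap_apply_def]; split_ifs with c1 c2
      · rw [c1] at h1; omega
      · rw [c2] at h1; omega
      · exact h1
    | R m =>
      simp only [On, hinv] at *
      rw [swap_apply_def]; split_ifs with c1 c2
      · rw [c1] at h1; omega
      · rw [c2] at h1; omega
      · exact h1
    | C s S =>
      simp only [On] at *
      rw [flag_swap u i j s (by omega)]; exact h1
  refine ⟨hF, ?_⟩
  rw [theta_eq p b K _ u hF hu]
  congr 1
  rcases hij with ⟨h1, h2⟩ | ⟨h1, h2⟩
  · exact hL u _ (swap_fix (by simpa [Lft] using h1) (by simpa [Lft] using h2))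
  · exact hR u _ (swap_fix (by simpa [Rgt] using h1) (by simpa [Rgt] using h2))

lemma disagree_lt {n : ℕ} (u v : Perm (Fin n)) (i : Fin n) (hi : u i ≠ v i) :
    (Finset.univ.filter (fun k => (u * swap i (u⁻¹ (v i))) k ≠ v k)).card <
      (Finset.univ.filter (fun k => u k ≠ v k)).card := by
  apply Finset.card_lt_card
  rw [Finset.ssubset_iff_of_subset]
  · refine ⟨i, by simpa using hi, ?_⟩
    rw [Finset.mem_filter, Perm.mul_apply, swap_apply_left, app_inv]
    simp
  · intro k hk
    simp only [Finset.mem_filter, Finset.mem_univ, true_and] at *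
    intro h
    apply hk
    have h1 : k ≠ i := fun hc => hi (hc ▸ h)
    have h2 : k ≠ u⁻¹ (v i) := by
      intro hc
      have : u k = v i := by rw [hc]; simp
      rw [h] at this
      exact h1 (v.injective this)
    rw [Perm.mul_apply, swap_apply_of_ne_of_ne h1 h2, h]

lemma theta_const {n : ℕ} {p b : ℕ} (hpb : p ≤ b) {K : Finset (Ky n)}
    {f : Perm (Fin n) → Rg n} (hf : GKM p b f) (hL : Inv (Lft n p) f) (hR : Inv (Rgt n b) f)
    (v : Perm (Fin n)) (hv : Face p b K v) (N : ℕ) : ∀ (u : Perm (Fin n)), Face p b K u →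
      (Finset.univ.filter (fun k => u k ≠ v k)).card = N →
      theta p b K u (f u) = theta p b K v (f v) := by
  induction N using Nat.strong_induction_on with
  | _ N ih =>
  intro u hu hN
  by_cases hA : ∃ i, u i ≠ v i ∧ ¬ Free K (v i)
  · obtain ⟨i, hi, hfr⟩ := hA
    have htw := twin_swap hpb hL hR u hu i (u⁻¹ (v i)) (by
      unfold Free at hfr
      by_cases hc : Ky.L (v i) ∈ K
      · left
        have h1 := hu _ hc
        have h2 := hv _ hc
        simp only [On, inv_app] at h1 h2
        exact ⟨h2, h1⟩
      · have hc : Ky.R (v i) ∈ K := by tauto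
        right
        have h1 := hu _ hc
        have h2 := hv _ hc
        simp only [On, inv_app] at h1 h2
        exact ⟨h2, h1⟩)
    rw [← htw.2]
    exact ih _ (hN ▸ disagree_lt u v i hi) _ htw.1 rfl
  · push Not at hA
    by_cases hB : ∃ i, u i ≠ v i
    · obtain ⟨i, hi⟩ := hB
      have hj : Free K (u (u⁻¹ (v i))) := by simpa using hA i hi
      have hi' : Free K (u i) := by
        by_contra hc
        have h1 : ¬ Free K (v (v⁻¹ (u i))) := by simpa using hc
        have h2 : u (v⁻¹ (u i)) = v (v⁻¹ (u i)) := by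
          by_contra h3; exact h1 (hA _ h3)
        rw [app_inv] at h2
        have h3 := u.injective h2
        rw [Perm.inv_eq_iff_eq] at h3
        exact hi h3
      have hbl : Blk K i (u⁻¹ (v i) : Fin n) := by
        intro s S h
        have h1 := face_flag hu h
        have h2 := face_flag hv h
        rw [h1] at h2
        have h3 := mem_flag u s (v i)
        rw [h2, mem_flag, inv_app] at h3
        exact h3
      have hne : i ≠ u⁻¹ (v i) := by
        intro hc; apply hi
        have : u i = u (u⁻¹ (v i)) := congrArg u hc
        simpa using this
      have hg := good_all hpb hf i (u⁻¹ (v i)) hne hbl u hu hi' hj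
      rw [← hg]
      exact ih _ (hN ▸ disagree_lt u v i hi) _ (face_swap hu hi' hj hbl) rfl
    · push Not at hB
      have : u = v := Equiv.ext hB
      rw [this]

lemma coeff_const {n : ℕ} {p b : ℕ} (hpb : p ≤ b)
    {f : Perm (Fin n) → Rg n} (hf : GKM p b f) (hL : Inv (Lft n p) f) (hR : Inv (Rgt n b) f)
    (u v : Perm (Fin n)) (α : Ky n →₀ ℕ) (hu : Face p b α.support u) (hv : Face p b α.support v) :
    coeff α (Psi p b u (f u)) = coeff α (Psi p b v (f v)) := by
  rw [← coeff_kill, ← coeff_kill α (Psi p b v (f v))]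
  exact congrArg (coeff α) (theta_const hpb hf hL hR v hv _ u hu rfl)

lemma invariant_mem {n : ℕ} (hn : 0 < n) {p b : ℕ} (hpb : p ≤ b)
    {f : Perm (Fin n) → Rg n} (hf : GKM p b f) (hL : Inv (Lft n p) f) (hR : Inv (Rgt n b) f)
    (A : Subring (Perm (Fin n) → Rg n)) (hA : ∀ κ, gen hn p b κ ∈ A) : f ∈ A := by
  classical
  let T : Finset (Ky n →₀ ℕ) := Finset.univ.biUnion (fun u => (Psi p b u (f u)).support)
  let c : (Ky n →₀ ℕ) → ℤ := fun α =>
    if h : ∃ u, Face p b α.support u then coeff α (Psi p b h.choose (f h.choose)) else 0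
  have key : f = ∑ α ∈ T, (c α : Perm (Fin n) → Rg n) *
      ∏ κ ∈ α.support, (gen hn p b κ) ^ (α κ) := by
    funext u
    rw [Finset.sum_apply]
    have h1 : f u = ev hn p b u (Psi p b u (f u)) := (ev_Psi hn p b hpb u (f u)).symm
    have h2 : Psi p b u (f u) = ∑ α ∈ T, monomial α (coeff α (Psi p b u (f u))) := by
      conv_lhs => rw [(Psi p b u (f u)).as_sum]
      apply Finset.sum_subset
      · intro α hα
        exact Finset.mem_biUnion.mpr ⟨u, Finset.mem_univ _, hα⟩
      · intro α _ hα
        rw [notMem_support_iff.mp hα, monomial_zero]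
    rw [h1, h2, map_sum]
    apply Finset.sum_congr rfl
    intro α _
    rw [ev, aeval_monomial, Finsupp.prod]
    simp only [Pi.mul_apply, Finset.prod_apply, Pi.pow_apply, Pi.intCast_apply]
    by_cases hF : Face p b α.support u
    · have hex : ∃ u, Face p b α.support u := ⟨u, hF⟩
      have h3 : c α = coeff α (Psi p b u (f u)) := by
        simp only [c]
        rw [dif_pos hex]
        exact coeff_const hpb hf hL hR _ _ α hex.choose_spec hF
      simp only [h3]
      congr 1
    · have h4 : ∏ κ ∈ α.support, gen hn p b κ u ^ α κ = 0 := by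
        unfold Face at hF
        push Not at hF
        obtain ⟨κ, hκ, hon⟩ := hF
        apply Finset.prod_eq_zero hκ
        rw [gen, if_neg hon]
        exact zero_pow (Finsupp.mem_support_iff.mp hκ)
      rw [h4, mul_zero, mul_zero]
  rw [key]
  refine A.sum_mem (fun α _ => A.mul_mem (intCast_mem A _) (A.prod_mem (fun κ _ =>
    A.pow_mem (hA κ) _)))

lemma peel {n : ℕ} (p b : ℕ) (A : Subring (Perm (Fin n) → Rg n))
    (hx : ∀ m : Fin n, (fun w : Perm (Fin n) => (X (w m) : Rg n)) ∈ A)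
    (W D : Finset (Fin n)) (hWD : ∀ i ∈ W, i ∉ D)
    (hadj : ∀ i ∈ W, ∀ j ∈ W, i ≠ j → Adj p b i j)
    (htwin : ∀ k ∈ W, ∀ m ∈ W, ∀ i j : Fin n, Adj p b i j →
      Adj p b (swap k m i) (swap k m j)) (C : Finset (Fin n)) (hCW : C ⊆ W)
    (hP : ∀ f, GKM p b f → Inv C f → Inv D f → f ∈ A) :
    ∀ f, GKM p b f → Inv D f → f ∈ A := by
  induction C using Finset.induction_on with
  | empty =>
    intro f hf hD
    refine hP f hf ?_ hD
    intro w π hπ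
    have : π = 1 := Equiv.ext (fun i => hπ i (Finset.notMem_empty i))
    rw [this, mul_one]
  | insert m C hm ih =>
    apply ih (fun i hi => hCW (Finset.mem_insert_of_mem hi))
    intro f hf hC hD
    have hmW : m ∈ W := hCW (Finset.mem_insert_self _ _)
    obtain ⟨N, c, hc, hfc⟩ := insertion_step p b C D m hm (fun i hi => hWD i (hCW hi))
      (fun i hi j hj => hadj i (hCW hi) j (hCW hj))
      (fun k hk => htwin k (hCW hk) m hmW) f hf hC hD
    rw [hfc]
    refine A.sum_mem (fun d _ => A.mul_mem (A.pow_mem (hx m) d) ?_)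
    exact hP _ (hc d).1 (hc d).2.1 (hc d).2.2

lemma adj_lift {n p b : ℕ} (σ : Perm (Fin n)) (i j : Fin n)
    (hσ : ∀ k : Fin n, σ k = k ∨ ((σ k : ℕ) < p ∧ (k : ℕ) < p) ∨ (b < (σ k : ℕ) ∧ b < (k : ℕ)))
    (hpb : p ≤ b) (h : Adj p b i j) : Adj p b (σ i) (σ j) := by
  have hne : (σ i : ℕ) ≠ (σ j : ℕ) := by
    intro hc
    exact h.1 (congrArg Fin.val (σ.injective (Fin.ext hc)))
  have hi := hσ i
  have hj := hσ j
  rw [Fin.ext_iff] at hi hj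
  unfold Adj at *
  omega

lemma mem_closure {n : ℕ} (hn : 0 < n) {p b : ℕ} (hpb : p ≤ b)
    (A : Subring (Perm (Fin n) → Rg n)) (hA : ∀ κ, gen hn p b κ ∈ A)
    (hx : ∀ m : Fin n, (fun w : Perm (Fin n) => (X (w m) : Rg n)) ∈ A)
    (f : Perm (Fin n) → Rg n) (hf : GKM p b f) : f ∈ A := by
  have s1 : ∀ f, GKM p b f → Inv (Rgt n b) f → f ∈ A := by
    refine peel p b A hx (Lft n p) (Rgt n b) ?_ ?_ ?_ (Lft n p) (Finset.Subset.refl _) ?_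
    · intro i hi; simp only [Lft, Rgt, Finset.mem_filter, Finset.mem_univ, true_and] at *; omega
    · intro i hi j hj hij
      simp only [Lft, Finset.mem_filter, Finset.mem_univ, true_and] at *
      rw [ne_eq, Fin.ext_iff] at hij
      unfold Adj; omega
    · intro k hk m hm i j hij
      simp only [Lft, Finset.mem_filter, Finset.mem_univ, true_and] at hk hm
      refine adj_lift (swap k m) i j ?_ hpb hij
      intro l
      rw [swap_apply_def]
      split_ifs with c1 c2
      · subst c1; right; left; exact ⟨hm, hk⟩
      · subst c2; right; left; exact ⟨hk, hm⟩
      · left; rfl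
    · intro f hf hL hR
      exact invariant_mem hn hpb hf hL hR A hA
  refine peel p b A hx (Rgt n b) ∅ ?_ ?_ ?_ (Rgt n b) (Finset.Subset.refl _)
    (fun f hf hR _ => s1 f hf hR) f hf ?_
  · intro i _; exact Finset.notMem_empty i
  · intro i hi j hj hij
    simp only [Rgt, Finset.mem_filter, Finset.mem_univ, true_and] at *
    rw [ne_eq, Fin.ext_iff] at hij
    unfold Adj; omega
  · intro k hk m hm i j hij
    simp only [Rgt, Finset.mem_filter, Finset.mem_univ, true_and] at hk hm
    refine adj_lift (swap k m) i j ?_ hpb hij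
    intro l
    rw [swap_apply_def]
    split_ifs with c1 c2
    · subst c1; right; right; exact ⟨hm, hk⟩
    · subst c2; right; right; exact ⟨hk, hm⟩
    · left; rfl
  · intro w π hπ
    have : π = 1 := Equiv.ext (fun i => hπ i (Finset.notMem_empty i))
    rw [this, mul_one]

lemma var_GKM {n : ℕ} (p b : ℕ) (m : Fin n) :
    GKM p b (fun w : Perm (Fin n) => (X (w m) : Rg n)) := by
  intro w i j _
  rw [← collapse_eq_iff]
  beta_reduce
  rw [Perm.mul_apply, collapse_swap]

lemma inGKM_iff {n : ℕ} (h : Fin n → Fin n) (p b : ℕ)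
    (hh : ∀ i j : Fin n, Adj p b i j ↔ ((j < i ∧ i ≤ h j) ∨ (i < j ∧ j ≤ h i)))
    (f : Perm (Fin n) → Rg n) : InGKM h f ↔ GKM p b f := by
  constructor
  · intro hf w i j hij
    rcases (hh i j).mp hij with ⟨h1, h2⟩ | ⟨h1, h2⟩
    · exact Ideal.mem_span_singleton.mp (hf w i j h1 h2)
    · have := Ideal.mem_span_singleton.mp (hf w j i h1 h2)
      rw [swap_comm, ← neg_sub]
      exact neg_dvd.mpr this
  · intro hf w i j h1 h2
    exact Ideal.mem_span_singleton.mpr (hf w i j ((hh i j).mpr (Or.inl ⟨h1, h2⟩)))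

end LolliAux

/-- if `h` is a Hessenberg function of lollipop form, then the GKM ring
`H(h)` (the equivariant cohomology `H*_T(X(h))`) is generated, as a ring, by the
constant functions together with its degree-2 elements. -/
theorem equivariant_generated_in_degree_two (n : ℕ)
    (h : Fin n → Fin n) (hmono : Monotone h) (hhess : ∀ j, j ≤ h j)
    (hlol : Lollipop h)
    (f : Equiv.Perm (Fin n) → MvPolynomial (Fin n) ℤ) (hf : InGKM h f) :
    f ∈ Subring.closure
      ({g : Equiv.Perm (Fin n) → MvPolynomial (Fin n) ℤ |
          ∃ p : MvPolynomial (Fin n) ℤ, g = Function.const _ p} ∪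
       {g : Equiv.Perm (Fin n) → MvPolynomial (Fin n) ℤ |
          InGKM h g ∧ ∀ w, (g w).IsHomogeneous 1}) := by
  obtain ⟨a, b, hab, hbn, h1, h2, h3⟩ := hlol
  have hn : 0 < n := by omega
  have hh : ∀ i j : Fin n, LolliAux.Adj (a + 1) b i j ↔
      ((j < i ∧ i ≤ h j) ∨ (i < j ∧ j ≤ h i)) := by
    have hv : ∀ j : Fin n, ((j : ℕ) ≤ a ∧ (h j : ℕ) = a + 1) ∨
        (a < (j : ℕ) ∧ (j : ℕ) < b ∧ (h j : ℕ) = (j : ℕ) + 1) ∨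
        (b ≤ (j : ℕ) ∧ (h j : ℕ) = n - 1) := by
      intro j
      by_cases c1 : (j : ℕ) ≤ a
      · exact Or.inl ⟨c1, h1 j c1⟩
      · by_cases c2 : (j : ℕ) < b
        · exact Or.inr (Or.inl ⟨by omega, c2, h2 j (by omega) c2⟩)
        · exact Or.inr (Or.inr ⟨by omega, h3 j (by omega)⟩)
    intro i j
    have hi := hv i
    have hj := hv j
    have li := i.2
    have lj := j.2
    simp only [Fin.lt_def, Fin.le_def]
    unfold LolliAux.Adj
    omega
  have hiff := LolliAux.inGKM_iff h (a + 1) b hh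
  refine LolliAux.mem_closure hn (p := a + 1) (b := b) hab _ ?_ ?_ f ((hiff f).mp hf)
  · intro κ
    apply Subring.subset_closure
    exact Or.inr ⟨(hiff _).mpr (LolliAux.gen_GKM hn (a + 1) b hab κ),
      LolliAux.gen_homog hn (a + 1) b κ⟩
  · intro m
    apply Subring.subset_closure
    exact Or.inr ⟨(hiff _).mpr (LolliAux.var_GKM (a + 1) b m), fun w => isHomogeneous_X _ _⟩
end
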